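/- arXiv:1512.04069 — 5 statements merged into one kernel-verified Lean document; each statement's English description precedes it below -/
import Mathlib

section
/- Let p > 1 and let q satisfy 1/p + 1/q = 1, let μ, σ ∈ ℝ with μ + σ = λ, and let k_λ be a nonnegative measurable function on (0,∞)×(0,∞) that is homogeneous of degree −λ, with k_λ⁽¹⁾(σ) := ∫₀^1 k_λ(1,t) t^{σ-1} dt satisfying 0 < k_λ⁽¹⁾(σ) < ∞. Let f, g be nonnegative measurable functions on (0,∞) such that 0 < ∫₀^∞ x^{p(1−μ)−1} f(x)^p dx < ∞ and 0 < ∫₀^∞ y^{q(1−σ)−1} g(y)^q dy < ∞. Then ∫₀^∞ (∫_y^∞ k_λ(x,y) f(x) dx) g(y) dy < k_λ⁽¹⁾(σ) · (∫₀^∞ x^{p(1−μ)−1} f(x)^p dx)^{1/p} · (∫₀^∞ y^{q(1−σ)−1} g(y)^q dy)^{1/q}, where the inner integral is over x ∈ (y, ∞). -/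
open MeasureTheory Set

theorem lintegral_image_const_mul {c : ℝ} (hc : 0 < c) {s : Set ℝ} (hs : MeasurableSet s)
    (φ : ℝ → ENNReal) :
    ∫⁻ x in (fun x => c * x) '' s, φ x = ∫⁻ x in s, ENNReal.ofReal c * φ (c * x) := by
  have h := lintegral_image_eq_lintegral_abs_deriv_mul (f := fun x => c * x) (f' := fun _ => c) hs
    (fun x _ => by simpa using ((hasDerivAt_id x).const_mul c).hasDerivWithinAt)
    (fun x _ y _ hxy => mul_left_cancel₀ hc.ne' hxy) φ
  simpa [abs_of_pos hc] using h

theorem lintegral_Ioi_const_mul {c : ℝ} (hc : 0 < c) (φ : ℝ → ENNReal) :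
    ∫⁻ x in Ioi (0 : ℝ), ENNReal.ofReal c * φ (c * x) = ∫⁻ x in Ioi (0 : ℝ), φ x := by
  rw [← lintegral_image_const_mul hc measurableSet_Ioi, image_mul_left_Ioi hc, mul_zero]

theorem lintegral_Ioo_const_mul {c : ℝ} (hc : 0 < c) (R : ℝ) (φ : ℝ → ENNReal) :
    ∫⁻ x in Ioo (0 : ℝ) R, ENNReal.ofReal c * φ (c * x) = ∫⁻ x in Ioo (0 : ℝ) (c * R), φ x := by
  rw [← lintegral_image_const_mul hc measurableSet_Ioo, image_mul_left_Ioo hc, mul_zero]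

/-- An integrable function on `(0, ∞)` two of whose distinct normalised dilates agree has integral
zero. -/
theorem lintegral_Ioi_eq_zero_of_dilate_ae_eq {c d : ℝ} (hd : 0 < d) (hdc : d < c)
    {φ : ℝ → ENNReal} (hfin : ∫⁻ x in Ioi (0 : ℝ), φ x ≠ ⊤)
    (h : ∀ᵐ y ∂volume.restrict (Ioi (0 : ℝ)),
      ENNReal.ofReal c * φ (c * y) = ENNReal.ofReal d * φ (d * y)) :
    ∫⁻ x in Ioi (0 : ℝ), φ x = 0 := by
  have hc : 0 < c := hd.trans hdc
  have hzero : ∀ R : ℝ, 0 < R → ∫⁻ x in Ico (d * R) (c * R), φ x = 0 := by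
    intro R hR
    have heq : ∫⁻ x in Ioo (0 : ℝ) (c * R), φ x = ∫⁻ x in Ioo (0 : ℝ) (d * R), φ x := by
      rw [← lintegral_Ioo_const_mul hc, ← lintegral_Ioo_const_mul hd]
      exact lintegral_congr_ae (ae_restrict_of_ae_restrict_of_subset Ioo_subset_Ioi_self h)
    have hsplit : Ioo (0 : ℝ) (c * R) = Ioo 0 (d * R) ∪ Ico (d * R) (c * R) :=
      (Ioo_union_Ico_eq_Ioo (by positivity) (by gcongr)).symm
    rw [hsplit, lintegral_union measurableSet_Ico] at heq
    · refine (ENNReal.add_right_inj ?_).1 (heq.trans (add_zero _).symm)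
      exact ne_top_of_le_ne_top hfin (lintegral_mono_set Ioo_subset_Ioi_self)
    · exact disjoint_left.2 fun x hx hx' => hx.2.not_ge hx'.1
  have hr : 1 < c / d := (one_lt_div hd).2 hdc
  have hcover : Ioi (0 : ℝ) ⊆ ⋃ n : ℤ, Ico (d * ((c / d) ^ n / d)) (c * ((c / d) ^ n / d)) := by
    intro x hx
    obtain ⟨n, hn1, hn2⟩ := exists_mem_Ico_zpow (mem_Ioi.1 hx) hr
    refine mem_iUnion.2 ⟨n, ?_, ?_⟩
    · rwa [mul_div_cancel₀ _ hd.ne']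
    · rw [zpow_add_one₀ (by positivity)] at hn2
      convert hn2 using 1
      ring
  refine le_antisymm ((lintegral_mono_set hcover).trans ((lintegral_iUnion_le _ _).trans ?_)) bot_le
  exact (ENNReal.tsum_eq_zero.2 fun n => hzero _ (by positivity)).le

/-- The equality case of Hölder's inequality. -/
theorem ae_eq_of_Lp_mul_Lq_le_lintegral_mul {α : Type*} [MeasurableSpace α] {ν : Measure α}
    {p q : ℝ} (hpq : p.HolderConjugate q) {u v : α → ENNReal}
    (hu : AEMeasurable u ν) (hv : AEMeasurable v ν)
    (hu0 : ∫⁻ a, u a ^ p ∂ν ≠ 0) (hu1 : ∫⁻ a, u a ^ p ∂ν ≠ ⊤)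
    (hv0 : ∫⁻ a, v a ^ q ∂ν ≠ 0) (hv1 : ∫⁻ a, v a ^ q ∂ν ≠ ⊤)
    (h : (∫⁻ a, u a ^ p ∂ν) ^ (1 / p) * (∫⁻ a, v a ^ q ∂ν) ^ (1 / q) ≤ ∫⁻ a, u a * v a ∂ν) :
    ∀ᵐ a ∂ν, u a ^ p = (∫⁻ a, u a ^ p ∂ν) * (v a ^ q * (∫⁻ a, v a ^ q ∂ν)⁻¹) := by
  set U := ENNReal.funMulInvSnorm u p ν with hU
  set V := ENNReal.funMulInvSnorm v q ν with hV
  have hU1 : ∫⁻ a, U a ^ p ∂ν = 1 :=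
    ENNReal.lintegral_rpow_funMulInvSnorm_eq_one hpq.pos hu0 hu1
  have hV1 : ∫⁻ a, V a ^ q ∂ν = 1 :=
    ENNReal.lintegral_rpow_funMulInvSnorm_eq_one hpq.symm.pos hv0 hv1
  have hUm : AEMeasurable U ν := hu.mul_const _
  have hVm : AEMeasurable V ν := hv.mul_const _
  have hsum : ∫⁻ a, U a ^ p / ENNReal.ofReal p + V a ^ q / ENNReal.ofReal q ∂ν = 1 := by
    simp only [div_eq_mul_inv]
    rw [lintegral_add_left' ((hUm.pow_const _).mul_const _),
      lintegral_mul_const'' _ (hUm.pow_const p), lintegral_mul_const'' _ (hVm.pow_const q),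
      hU1, hV1, one_mul, one_mul, hpq.inv_add_inv_ennreal]
  set C := (∫⁻ a, u a ^ p ∂ν) ^ (1 / p) * (∫⁻ a, v a ^ q ∂ν) ^ (1 / q) with hC
  have hC0 : C ≠ 0 := by simp [hC, hu0, hu1, hv0, hv1]
  have hC1 : C ≠ ⊤ := by simp [hC, hu0, hu1, hv0, hv1, ENNReal.mul_eq_top]
  have hprod : ∫⁻ a, u a * v a ∂ν = (∫⁻ a, U a * V a ∂ν) * C := by
    rw [← lintegral_mul_const' _ _ hC1]
    refine lintegral_congr fun a => ?_
    rw [ENNReal.fun_eq_funMulInvSnorm_mul_eLpNorm u hu0 hu1,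
      ENNReal.fun_eq_funMulInvSnorm_mul_eLpNorm v hv0 hv1]
    ring
  have hone : 1 ≤ ∫⁻ a, U a * V a ∂ν := by
    rw [hprod] at h
    exact (ENNReal.mul_le_mul_iff_left hC0 hC1).1 (by simpa using h)
  have hyoung : ∀ a, U a * V a ≤ U a ^ p / ENNReal.ofReal p + V a ^ q / ENNReal.ofReal q :=
    fun a => ENNReal.young_inequality _ _ hpq
  have hae := ae_eq_of_ae_le_of_lintegral_le (.of_forall hyoung)
    (ne_top_of_le_ne_top ENNReal.one_ne_top ((lintegral_mono hyoung).trans hsum.le))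
    (((hUm.pow_const _).div_const _).add ((hVm.pow_const _).div_const _)) (hsum.le.trans hone)
  have hUt : ∀ᵐ a ∂ν, U a ^ p < ⊤ := ae_lt_top' (hUm.pow_const _) (by simp [hU1])
  have hVt : ∀ᵐ a ∂ν, V a ^ q < ⊤ := ae_lt_top' (hVm.pow_const _) (by simp [hV1])
  filter_upwards [hae, hUt, hVt] with a ha hUa hVa
  have key : U a ^ p = V a ^ q := by
    rcases (ENNReal.young_inequality_eq_iff _ _ hpq).1 ha with h1 | h1 | h1
    · simp [h1.1, hpq.pos] at hUa
    · simp [h1.2, hpq.symm.pos] at hVa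
    · exact h1
  rw [hU, hV, ENNReal.funMulInvSnorm_rpow hpq.pos, ENNReal.funMulInvSnorm_rpow hpq.symm.pos] at key
  rw [← key, mul_left_comm, ENNReal.mul_inv_cancel hu0 hu1, mul_one]

/-- The strict Hölder bound for an average of the pairings of dilates of `u` with `v`. -/
theorem lintegral_mul_lintegral_dilate_mul_lt {p q : ℝ} (hpq : p.HolderConjugate q)
    {K u v : ℝ → ENNReal} (hK : Measurable K) (hu : Measurable u) (hv : Measurable v)
    {s : Set ℝ} (hs : MeasurableSet s) (hspos : s ⊆ Ioi 0)
    (hK0 : ∫⁻ t in s, K t ≠ 0) (hK1 : ∫⁻ t in s, K t ≠ ⊤)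
    (hu0 : ∫⁻ x in Ioi (0 : ℝ), u x ^ p ≠ 0) (hu1 : ∫⁻ x in Ioi (0 : ℝ), u x ^ p ≠ ⊤)
    (hv0 : ∫⁻ y in Ioi (0 : ℝ), v y ^ q ≠ 0) (hv1 : ∫⁻ y in Ioi (0 : ℝ), v y ^ q ≠ ⊤) :
    ∫⁻ t in s, K t * ∫⁻ y in Ioi (0 : ℝ), ENNReal.ofReal (t⁻¹ ^ (1 / p)) * u (t⁻¹ * y) * v y
      < (∫⁻ t in s, K t) * (∫⁻ x in Ioi (0 : ℝ), u x ^ p) ^ (1 / p) *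
        (∫⁻ y in Ioi (0 : ℝ), v y ^ q) ^ (1 / q) := by
  set A := ∫⁻ x in Ioi (0 : ℝ), u x ^ p with hA
  set B := ∫⁻ y in Ioi (0 : ℝ), v y ^ q with hB
  set w : ℝ → ℝ → ENNReal := fun t y => ENNReal.ofReal (t⁻¹ ^ (1 / p)) * u (t⁻¹ * y) with hw
  set Φ : ℝ → ENNReal := fun t => ∫⁻ y in Ioi (0 : ℝ), w t y * v y with hΦ
  set C := A ^ (1 / p) * B ^ (1 / q) with hC
  have hC1 : C ≠ ⊤ := by simp [hC, hu0, hu1, hv0, hv1, ENNReal.mul_eq_top]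
  have hwm : ∀ t, Measurable (w t) := fun t => by fun_prop
  have hwp : ∀ t, 0 < t → ∀ y, w t y ^ p = ENNReal.ofReal t⁻¹ * u (t⁻¹ * y) ^ p := by
    intro t ht y
    rw [hw, ENNReal.mul_rpow_of_nonneg _ _ hpq.nonneg,
      ENNReal.ofReal_rpow_of_nonneg (by positivity) hpq.nonneg, ← Real.rpow_mul (by positivity),
      one_div_mul_cancel hpq.ne_zero, Real.rpow_one]
  have hwA : ∀ t, 0 < t → ∫⁻ y in Ioi (0 : ℝ), w t y ^ p = A := by
    intro t ht
    simp_rw [hwp t ht]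
    exact lintegral_Ioi_const_mul (inv_pos.2 ht) fun x => u x ^ p
  have hΦle : ∀ t, 0 < t → Φ t ≤ C := by
    intro t ht
    have := ENNReal.lintegral_mul_le_Lp_mul_Lq (volume.restrict (Ioi (0 : ℝ))) hpq
      (hwm t).aemeasurable hv.aemeasurable
    rwa [hwA t ht] at this
  have heq : ∀ t, 0 < t → C ≤ Φ t → ∀ᵐ y ∂volume.restrict (Ioi (0 : ℝ)),
      ENNReal.ofReal t⁻¹ * u (t⁻¹ * y) ^ p = A * (v y ^ q * B⁻¹) := by
    intro t ht h
    have := ae_eq_of_Lp_mul_Lq_le_lintegral_mul hpq (hwm t).aemeasurable hv.aemeasurable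
      (by rwa [hwA t ht]) (by rwa [hwA t ht]) hv0 hv1 (by rwa [hwA t ht])
    rw [hwA t ht] at this
    simpa only [hwp t ht] using this
  have hnot : ∀ a b, 0 < a → a < b → C ≤ Φ a → ¬ C ≤ Φ b := by
    intro a b ha hab hCa hCb
    refine hu0 (lintegral_Ioi_eq_zero_of_dilate_ae_eq (φ := fun x => u x ^ p)
      (inv_pos.2 (ha.trans hab)) (inv_strictAnti₀ ha hab) hu1 ?_)
    filter_upwards [heq a ha hCa, heq b (ha.trans hab) hCb] with y h1 h2
    rw [h1, h2]
  have hsub : {t | 0 < t ∧ C ≤ Φ t}.Subsingleton := by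
    rintro a ⟨ha, hCa⟩ b ⟨hb, hCb⟩
    rcases lt_trichotomy a b with h | h | h
    · exact (hnot a b ha h hCa hCb).elim
    · exact h
    · exact (hnot b a hb h hCb hCa).elim
  have hlt : ∀ᵐ t ∂volume.restrict s, Φ t < C := by
    rw [ae_restrict_iff' hs]
    filter_upwards [measure_eq_zero_iff_ae_notMem.1 (hsub.measure_zero volume)] with t ht hts
    exact not_le.1 fun h => ht ⟨hspos hts, h⟩
  rw [mul_assoc, ← hC]
  by_contra! hle
  rw [← lintegral_mul_const' _ _ hC1] at hle
  have hmono : ∀ᵐ t ∂volume.restrict s, K t * Φ t ≤ K t * C := by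
    filter_upwards [hlt] with t ht
    gcongr
  have hae := ae_eq_of_ae_le_of_lintegral_le hmono
    (ne_top_of_le_ne_top (ENNReal.mul_ne_top hK1 hC1)
      ((lintegral_mono_ae hmono).trans (lintegral_mul_const' _ _ hC1).le))
    (hK.mul_const _).aemeasurable hle
  refine hK0 (lintegral_eq_zero_of_ae_eq_zero ?_)
  filter_upwards [hae, hlt, ae_lt_top hK hK1] with t h1 h2 h3
  by_contra h0
  exact h2.ne ((ENNReal.mul_right_inj h0 h3.ne).1 h1)

/-- The substitution `x = y / t`. -/
theorem lintegral_Ioi_eq_lintegral_Ioo_inv_mul {y : ℝ} (hy : 0 < y) (φ : ℝ → ENNReal) :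
    ∫⁻ x in Ioi y, φ x =
      ∫⁻ t in Ioo (0 : ℝ) 1, ENNReal.ofReal ((t ^ 2)⁻¹ * y) * φ (t⁻¹ * y) := by
  have himage : (fun t : ℝ => t⁻¹ * y) '' Ioo 0 1 = Ioi y := by
    ext x
    constructor
    · rintro ⟨t, ⟨ht0, ht1⟩, rfl⟩
      exact lt_mul_of_one_lt_left hy ((one_lt_inv₀ ht0).2 ht1)
    · intro hx
      have hx0 : 0 < x := hy.trans hx
      refine ⟨y / x, ⟨by positivity, (div_lt_one hx0).2 hx⟩, ?_⟩
      simp only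
      field_simp
  rw [← himage, lintegral_image_eq_lintegral_abs_deriv_mul (f' := fun t => -(t ^ 2)⁻¹ * y)
    measurableSet_Ioo
    (fun t ht => ((hasDerivAt_inv ht.1.ne').mul_const y).hasDerivWithinAt)
    (fun a _ b _ hab => inv_injective (mul_right_cancel₀ hy.ne' hab))]
  refine setLIntegral_congr_fun measurableSet_Ioo fun t ht => ?_
  simp only [neg_mul, abs_neg]
  rw [abs_of_nonneg (by positivity)]

/-- The powers of `y` and `t` produced by the substitution `x = y / t`. -/
theorem rpow_weights_identity {p q mu σ : ℝ} (hpq : 1 / p + 1 / q = 1) {t y : ℝ}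
    (ht : 0 < t) (hy : 0 < y) :
    (t ^ 2)⁻¹ * y * (t⁻¹ * y) ^ (-(mu + σ)) =
      t ^ (σ - 1) * t⁻¹ ^ (1 / p) * (t⁻¹ * y) ^ (1 - mu - 1 / p) * y ^ (1 - σ - 1 / q) := by
  obtain ⟨T, rfl⟩ : ∃ T, Real.exp T = t := ⟨_, Real.exp_log ht⟩
  obtain ⟨Y, rfl⟩ : ∃ Y, Real.exp Y = y := ⟨_, Real.exp_log hy⟩
  have hq : 1 / q = 1 - 1 / p := by linarith
  simp only [← Real.exp_nat_mul, ← Real.exp_neg, ← Real.exp_add, ← Real.exp_mul, hq]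
  congr 1
  push_cast
  ring

theorem ofReal_rpow_mul_rpow {r e x z : ℝ} (hr : 0 < r) (hx : 0 < x) (hz : 0 ≤ z) :
    ENNReal.ofReal (x ^ (e - 1 / r) * z) ^ r = ENNReal.ofReal (x ^ (r * e - 1) * z ^ r) := by
  rw [ENNReal.ofReal_rpow_of_nonneg (by positivity) hr.le, Real.mul_rpow (by positivity) hz,
    ← Real.rpow_mul hx.le, sub_mul, one_div_mul_cancel hr.ne', mul_comm e]

/-- First-kind Hardy-type inequality with homogeneous kernel of degree `-λ`
(here `k_λ(1,t) = 0` for `t > 1` is not assumed; the kernel is simply truncated to `x > y`):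
`∫₀^∞ (∫_y^∞ k_λ(x,y) f(x) dx) g(y) dy
  < k_λ⁽¹⁾(σ) (∫₀^∞ x^{p(1-μ)-1} f^p)^{1/p} (∫₀^∞ y^{q(1-σ)-1} g^q)^{1/q}`,
where `k_λ⁽¹⁾(σ) = ∫₀^1 k_λ(1,t) t^{σ-1} dt`. -/
theorem stmt13 (p q lam mu σ : ℝ) (hp : 1 < p) (hpq : 1 / p + 1 / q = 1)
    (hms : mu + σ = lam)
    (k : ℝ → ℝ → ℝ) (hkm : Measurable (Function.uncurry k))
    (hk0 : ∀ x y : ℝ, 0 < x → 0 < y → 0 ≤ k x y)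
    (hhom : ∀ t x y : ℝ, 0 < t → 0 < x → 0 < y → k (t * x) (t * y) = t ^ (-lam) * k x y)
    (hK0 : 0 < ∫⁻ t in Ioo (0 : ℝ) 1, ENNReal.ofReal (k 1 t * t ^ (σ - 1)))
    (hK1 : (∫⁻ t in Ioo (0 : ℝ) 1, ENNReal.ofReal (k 1 t * t ^ (σ - 1))) < ⊤)
    (f g : ℝ → ℝ) (hf : Measurable f) (hg : Measurable g)
    (hf0 : ∀ x ∈ Ioi (0 : ℝ), 0 ≤ f x) (hg0 : ∀ y ∈ Ioi (0 : ℝ), 0 ≤ g y)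
    (hA0 : 0 < ∫⁻ x in Ioi (0 : ℝ), ENNReal.ofReal (x ^ (p * (1 - mu) - 1) * f x ^ p))
    (hA1 : (∫⁻ x in Ioi (0 : ℝ), ENNReal.ofReal (x ^ (p * (1 - mu) - 1) * f x ^ p)) < ⊤)
    (hB0 : 0 < ∫⁻ y in Ioi (0 : ℝ), ENNReal.ofReal (y ^ (q * (1 - σ) - 1) * g y ^ q))
    (hB1 : (∫⁻ y in Ioi (0 : ℝ), ENNReal.ofReal (y ^ (q * (1 - σ) - 1) * g y ^ q)) < ⊤) :
    (∫⁻ y in Ioi (0 : ℝ),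
        (∫⁻ x in Ioi y, ENNReal.ofReal (k x y * f x)) * ENNReal.ofReal (g y))
      < (∫⁻ t in Ioo (0 : ℝ) 1, ENNReal.ofReal (k 1 t * t ^ (σ - 1))) *
          (∫⁻ x in Ioi (0 : ℝ), ENNReal.ofReal (x ^ (p * (1 - mu) - 1) * f x ^ p)) ^ (1 / p) *
          (∫⁻ y in Ioi (0 : ℝ), ENNReal.ofReal (y ^ (q * (1 - σ) - 1) * g y ^ q)) ^ (1 / q) := by
  subst hms
  have hconj : p.HolderConjugate q := by
    rw [Real.holderConjugate_iff]
    exact ⟨hp, by simpa using hpq⟩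
  set K : ℝ → ENNReal := fun t => ENNReal.ofReal (k 1 t * t ^ (σ - 1)) with hK
  set u : ℝ → ENNReal := fun x => ENNReal.ofReal (x ^ (1 - mu - 1 / p) * f x) with hu
  set v : ℝ → ENNReal := fun y => ENNReal.ofReal (y ^ (1 - σ - 1 / q) * g y) with hv
  have hk1 : Measurable fun t => k 1 t := hkm.comp measurable_prodMk_left
  have hKm : Measurable K := by fun_prop
  have hum : Measurable u := by fun_prop
  have hvm : Measurable v := by fun_prop
  have hA : ∫⁻ x in Ioi (0 : ℝ), ENNReal.ofReal (x ^ (p * (1 - mu) - 1) * f x ^ p) =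
      ∫⁻ x in Ioi (0 : ℝ), u x ^ p :=
    setLIntegral_congr_fun measurableSet_Ioi fun x hx =>
      (ofReal_rpow_mul_rpow hconj.pos hx (hf0 x hx)).symm
  have hB : ∫⁻ y in Ioi (0 : ℝ), ENNReal.ofReal (y ^ (q * (1 - σ) - 1) * g y ^ q) =
      ∫⁻ y in Ioi (0 : ℝ), v y ^ q :=
    setLIntegral_congr_fun measurableSet_Ioi fun y hy =>
      (ofReal_rpow_mul_rpow hconj.symm.pos hy (hg0 y hy)).symm
  rw [hA] at hA0 hA1 ⊢
  rw [hB] at hB0 hB1 ⊢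
  have hinner : ∀ y ∈ Ioi (0 : ℝ),
      (∫⁻ x in Ioi y, ENNReal.ofReal (k x y * f x)) * ENNReal.ofReal (g y) =
        ∫⁻ t in Ioo (0 : ℝ) 1,
          K t * (ENNReal.ofReal (t⁻¹ ^ (1 / p)) * u (t⁻¹ * y) * v y) := by
    intro y hy
    have hy : 0 < y := hy
    rw [lintegral_Ioi_eq_lintegral_Ioo_inv_mul hy, ← lintegral_mul_const' _ _ ENNReal.ofReal_ne_top]
    refine setLIntegral_congr_fun measurableSet_Ioo fun t ht => ?_
    have ht0 : 0 < t := ht.1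
    have hty : 0 < t⁻¹ * y := by positivity
    have hk : k (t⁻¹ * y) y = (t⁻¹ * y) ^ (-(mu + σ)) * k 1 t := by
      have h := hhom (t⁻¹ * y) 1 t hty one_pos ht0
      rwa [mul_one, mul_right_comm, inv_mul_cancel₀ ht0.ne', one_mul] at h
    have hkt := hk0 1 t one_pos ht0
    have hft := hf0 _ hty
    have hgy := hg0 y hy
    simp only [hK, hu, hv]
    rw [hk, ← ENNReal.ofReal_mul (by positivity), ← ENNReal.ofReal_mul (by positivity),
      ← ENNReal.ofReal_mul (by positivity), ← ENNReal.ofReal_mul (by positivity),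
      ← ENNReal.ofReal_mul (by positivity)]
    congr 1
    linear_combination
      (k 1 t * f (t⁻¹ * y) * g y) * rpow_weights_identity (mu := mu) (σ := σ) hpq ht0 hy
  have hswap : ∫⁻ y in Ioi (0 : ℝ),
        (∫⁻ x in Ioi y, ENNReal.ofReal (k x y * f x)) * ENNReal.ofReal (g y) =
      ∫⁻ t in Ioo (0 : ℝ) 1,
        K t * ∫⁻ y in Ioi (0 : ℝ), ENNReal.ofReal (t⁻¹ ^ (1 / p)) * u (t⁻¹ * y) * v y := by
    rw [setLIntegral_congr_fun measurableSet_Ioi hinner, lintegral_lintegral_swap]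
    · exact lintegral_congr fun t => lintegral_const_mul' _ _ ENNReal.ofReal_ne_top
    · refine Measurable.aemeasurable ?_
      unfold Function.uncurry
      fun_prop
  rw [hswap]
  exact lintegral_mul_lintegral_dilate_mul_lt hconj hKm hum hvm measurableSet_Ioo
    Ioo_subset_Ioi_self hK0.ne' hK1.ne hA0.ne' hA1.ne hB0.ne' hB1.ne
end

section
/- Let p > 1 and let q satisfy 1/p + 1/q = 1, let μ, σ ∈ ℝ with μ + σ = λ, and let k_λ be a nonnegative measurable function on (0,∞)×(0,∞) that is homogeneous of degree −λ, with k_λ⁽²⁾(σ) := ∫₁^∞ k_λ(1,t) t^{σ-1} dt satisfying 0 < k_λ⁽²⁾(σ) < ∞. Let f, g be nonnegative measurable functions on (0,∞) such that 0 < ∫₀^∞ x^{p(1−μ)−1} f(x)^p dx < ∞ and 0 < ∫₀^∞ y^{q(1−σ)−1} g(y)^q dy < ∞. Then ∫₀^∞ (∫₀^y k_λ(x,y) f(x) dx) g(y) dy < k_λ⁽²⁾(σ) · (∫₀^∞ x^{p(1−μ)−1} f(x)^p dx)^{1/p} · (∫₀^∞ y^{q(1−σ)−1} g(y)^q dy)^{1/q},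 where the inner integral is over x ∈ (0, y). -/
open MeasureTheory Set

open scoped ENNReal

lemma ENNReal.rpow_mul_rpow_le_add_and_eq {α β : ℝ} (hα : 0 < α) (hβ : 0 < β)
    (hαβ : α + β = 1) {a b : ℝ≥0∞} (ha : a ≠ ⊤) (hb : b ≠ ⊤) :
    a ^ α * b ^ β ≤ ENNReal.ofReal α * a + ENNReal.ofReal β * b ∧
      (a ^ α * b ^ β = ENNReal.ofReal α * a + ENNReal.ofReal β * b → a = b) := by
  lift a to NNReal using ha
  lift b to NNReal using hb
  rw [← ENNReal.ofReal_coe_nnreal (p := a), ← ENNReal.ofReal_coe_nnreal (p := b),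
    ENNReal.ofReal_rpow_of_nonneg a.coe_nonneg hα.le, ENNReal.ofReal_rpow_of_nonneg b.coe_nonneg hβ.le,
    ← ENNReal.ofReal_mul (by positivity), ← ENNReal.ofReal_mul hα.le,
    ← ENNReal.ofReal_mul hβ.le, ← ENNReal.ofReal_add (by positivity) (by positivity)]
  refine ⟨ENNReal.ofReal_le_ofReal
    (Real.geom_mean_le_arith_mean2_weighted hα.le hβ.le a.coe_nonneg b.coe_nonneg hαβ), fun h => ?_⟩
  rw [ENNReal.ofReal_eq_ofReal_iff (by positivity) (by positivity)] at h
  rw [(Real.geom_mean_eq_arith_mean2_weighted_iff_of_pos hα hβ a.coe_nonneg b.coe_nonneg hαβ).1 h]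

/-- The equality case of Hölder's inequality. -/
lemma ae_eq_of_holder_eq {X : Type*} [MeasurableSpace X] {μ : Measure X} {α β : ℝ}
    (hα : 0 < α) (hβ : 0 < β) (hαβ : α + β = 1) {U V : X → ℝ≥0∞}
    (hU : Measurable U) (hV : Measurable V)
    (hA0 : ∫⁻ x, U x ∂μ ≠ 0) (hA : ∫⁻ x, U x ∂μ ≠ ⊤)
    (hB0 : ∫⁻ x, V x ∂μ ≠ 0) (hB : ∫⁻ x, V x ∂μ ≠ ⊤)
    (h : ∫⁻ x, U x ^ α * V x ^ β ∂μ = (∫⁻ x, U x ∂μ) ^ α * (∫⁻ x, V x ∂μ) ^ β) :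
    ∀ᵐ x ∂μ, U x / ∫⁻ x, U x ∂μ = V x / ∫⁻ x, V x ∂μ := by
  set A := ∫⁻ x, U x ∂μ
  set B := ∫⁻ x, V x ∂μ
  have young : ∀ᵐ x ∂μ, (U x / A) ^ α * (V x / B) ^ β
        ≤ ENNReal.ofReal α * (U x / A) + ENNReal.ofReal β * (V x / B) ∧
      ((U x / A) ^ α * (V x / B) ^ β
        = ENNReal.ofReal α * (U x / A) + ENNReal.ofReal β * (V x / B) → U x / A = V x / B) := by
    filter_upwards [ae_lt_top hU hA, ae_lt_top hV hB] with x hx hy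
    exact ENNReal.rpow_mul_rpow_le_add_and_eq hα hβ hαβ
      (ENNReal.div_ne_top hx.ne hA0) (ENNReal.div_ne_top hy.ne hB0)
  have hC0 : A ^ α * B ^ β ≠ 0 := by
    simp [ENNReal.rpow_eq_zero_iff, hA0, hB0, hA, hB]
  have hC : A ^ α * B ^ β ≠ ⊤ := ENNReal.mul_ne_top
    (ENNReal.rpow_ne_top_of_nonneg hα.le hA) (ENNReal.rpow_ne_top_of_nonneg hβ.le hB)
  have hleft : ∫⁻ x, (U x / A) ^ α * (V x / B) ^ β ∂μ = 1 := by
    have hpt : ∀ x, (U x / A) ^ α * (V x / B) ^ β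
        = (A ^ α * B ^ β)⁻¹ * (U x ^ α * V x ^ β) := fun x => by
      rw [ENNReal.div_rpow_of_nonneg _ _ hα.le, ENNReal.div_rpow_of_nonneg _ _ hβ.le,
        ENNReal.mul_inv (Or.inr (ENNReal.rpow_ne_top_of_nonneg hβ.le hB))
          (Or.inl (ENNReal.rpow_ne_top_of_nonneg hα.le hA)), div_eq_mul_inv, div_eq_mul_inv]
      ring
    simp_rw [hpt]
    rw [lintegral_const_mul _ (by fun_prop), h, ENNReal.inv_mul_cancel hC0 hC]
  have hright : ∫⁻ x, (ENNReal.ofReal α * (U x / A) + ENNReal.ofReal β * (V x / B)) ∂μ = 1 := by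
    simp_rw [div_eq_mul_inv]
    rw [lintegral_add_left (by fun_prop), lintegral_const_mul _ (by fun_prop),
      lintegral_const_mul _ (by fun_prop), lintegral_mul_const _ hU, lintegral_mul_const _ hV,
      ENNReal.mul_inv_cancel hA0 hA, ENNReal.mul_inv_cancel hB0 hB, mul_one, mul_one,
      ← ENNReal.ofReal_add hα.le hβ.le, hαβ, ENNReal.ofReal_one]
  have hae := ae_eq_of_ae_le_of_lintegral_le (young.mono fun x hx => hx.1)
    (by simp [hleft]) (by fun_prop) (by rw [hleft, hright])
  filter_upwards [young, hae] with x hx hx'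
  exact hx.2 hx'

lemma lintegral_image_mul_left {c : ℝ} (hc : 0 < c) {s : Set ℝ} (hs : MeasurableSet s)
    (h : ℝ → ℝ≥0∞) :
    ∫⁻ x in s, ENNReal.ofReal c * h (c * x) = ∫⁻ y in (c * ·) '' s, h y := by
  rw [lintegral_image_eq_lintegral_abs_deriv_mul (f' := fun _ => c) hs
    (fun x _ => by simpa using ((hasDerivAt_id x).const_mul c).hasDerivWithinAt)
    (fun x _ y _ hxy => mul_left_cancel₀ hc.ne' hxy), abs_of_pos hc]

/-- A finite density on `(0, ∞)` whose mass is invariant under a dilation vanishes. -/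
lemma lintegral_eq_zero_of_dilation_invariant {r : ℝ} (hr : 1 < r) {v : ℝ → ℝ≥0∞}
    (hv : ∫⁻ x in Ioi 0, v x ≠ ⊤)
    (hinv : ∀ a : ℝ, 0 < a → ∫⁻ x in Ioo 0 (r * a), v x = ∫⁻ x in Ioo 0 a, v x) :
    ∫⁻ x in Ioi 0, v x = 0 := by
  have hr0 : 0 < r := by linarith
  have hpow : ∀ (n : ℕ) (a : ℝ), 0 < a →
      ∫⁻ x in Ioo 0 (r ^ n * a), v x = ∫⁻ x in Ioo 0 a, v x := by
    intro n
    induction n with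
    | zero => simp
    | succ n ih =>
      intro a ha
      rw [pow_succ', mul_assoc, hinv _ (by positivity), ih a ha]
  have htend : Filter.Tendsto (fun n : ℕ => ∫⁻ x in Ioo 0 ((r⁻¹) ^ n), v x)
      Filter.atTop (nhds 0) := by
    have hmeas : Filter.Tendsto (fun n : ℕ => (volume.restrict (Ioi (0 : ℝ))) (Ioo 0 ((r⁻¹) ^ n)))
        Filter.atTop (nhds 0) := by
      have := ENNReal.tendsto_ofReal (tendsto_pow_atTop_nhds_zero_of_lt_one
        (inv_nonneg.2 hr0.le) (inv_lt_one_of_one_lt₀ hr))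
      rw [ENNReal.ofReal_zero] at this
      refine this.congr fun n => ?_
      rw [Measure.restrict_apply measurableSet_Ioo,
        inter_eq_self_of_subset_left (fun x hx => hx.1), Real.volume_Ioo, sub_zero]
    refine (tendsto_setLIntegral_zero hv hmeas).congr fun n => ?_
    rw [Measure.restrict_restrict measurableSet_Ioo,
      inter_eq_self_of_subset_left (fun x hx => hx.1)]
  have hone : ∫⁻ x in Ioo 0 1, v x = 0 := by
    refine tendsto_nhds_unique (tendsto_const_nhds.congr fun n : ℕ => ?_) htend
    rw [← hpow n ((r⁻¹) ^ n) (by positivity), ← mul_pow, mul_inv_cancel₀ hr0.ne', one_pow]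
  have hUnion : Ioi (0 : ℝ) = ⋃ n : ℕ, Ioo 0 (r ^ n) := by
    ext x
    simp only [mem_Ioi, mem_iUnion, mem_Ioo, exists_and_left, iff_self_and]
    exact fun _ => pow_unbounded_of_one_lt x hr
  rw [hUnion, setLIntegral_iUnion_of_directed _ (Monotone.directed_le fun m n hmn =>
    Ioo_subset_Ioo_right (pow_le_pow_right₀ hr.le hmn))]
  simp only [ENNReal.iSup_eq_zero]
  intro n
  have := hpow n 1 one_pos
  rwa [mul_one, hone] at this

lemma subsingleton_dilations_holder_eq {α β : ℝ} (hα : 0 < α) (hβ : 0 < β) (hαβ : α + β = 1)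
    {u v : ℝ → ℝ≥0∞} (hu : Measurable u) (hv : Measurable v)
    (hA0 : ∫⁻ x in Ioi 0, u x ≠ 0) (hA : ∫⁻ x in Ioi 0, u x ≠ ⊤)
    (hB0 : ∫⁻ x in Ioi 0, v x ≠ 0) (hB : ∫⁻ x in Ioi 0, v x ≠ ⊤) :
    {t : ℝ | 0 < t ∧ ∫⁻ x in Ioi 0, u x ^ α * (ENNReal.ofReal t * v (t * x)) ^ β
      = (∫⁻ x in Ioi 0, u x) ^ α * (∫⁻ x in Ioi 0, v x) ^ β}.Subsingleton := by
  have hscale : ∀ t : ℝ, 0 < t →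
      ∫⁻ x in Ioi 0, ENNReal.ofReal t * v (t * x) = ∫⁻ x in Ioi 0, v x := fun t ht => by
    rw [lintegral_image_mul_left ht measurableSet_Ioi, image_mul_left_Ioi ht, mul_zero]
  have hae : ∀ t : ℝ, 0 < t → ∫⁻ x in Ioi 0, u x ^ α * (ENNReal.ofReal t * v (t * x)) ^ β
      = (∫⁻ x in Ioi 0, u x) ^ α * (∫⁻ x in Ioi 0, v x) ^ β →
      ∀ᵐ x ∂volume.restrict (Ioi (0 : ℝ)), u x / ∫⁻ x in Ioi 0, u x
        = ENNReal.ofReal t * v (t * x) / ∫⁻ x in Ioi 0, v x := by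
    intro t ht h
    have := ae_eq_of_holder_eq (μ := volume.restrict (Ioi (0 : ℝ))) hα hβ hαβ hu
      (V := fun x => ENNReal.ofReal t * v (t * x)) (by fun_prop) hA0 hA
      (by rwa [hscale t ht]) (by rwa [hscale t ht]) (by rwa [hscale t ht])
    rwa [hscale t ht] at this
  intro s hs t ht
  wlog hst : s < t generalizing s t
  · rcases (not_lt.1 hst).lt_or_eq with h | h
    · exact (this ht hs h).symm
    · exact h.symm
  obtain ⟨hs0, hs⟩ := hs
  obtain ⟨ht0, ht⟩ := ht
  refine absurd (lintegral_eq_zero_of_dilation_invariant ((one_lt_div hs0).2 hst) hB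
    fun a ha => ?_) hB0
  have hmass : ∀ c : ℝ, 0 < c → ∫⁻ x in Ioo 0 (a / s), ENNReal.ofReal c * v (c * x)
      = ∫⁻ x in Ioo 0 (c * (a / s)), v x := fun c hc => by
    rw [lintegral_image_mul_left hc measurableSet_Ioo, image_mul_left_Ioo hc, mul_zero]
  have e1 := hmass s hs0
  have e2 := hmass t ht0
  rw [mul_div_cancel₀ _ hs0.ne'] at e1
  rw [div_mul_eq_mul_div, mul_div_assoc, ← e1, ← e2]
  refine lintegral_congr_ae (ae_restrict_of_ae_restrict_of_subset
    (fun x hx => hx.1 : Ioo 0 (a / s) ⊆ Ioi 0) ?_)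
  filter_upwards [hae s hs0 hs, hae t ht0 ht] with x h1 h2
  rwa [h1, ENNReal.div_eq_div_iff hB0 hB hB0 hB, ENNReal.mul_right_inj hB0 hB, eq_comm] at h2

lemma lintegral_dilations_lt {α β : ℝ} (hα : 0 < α) (hβ : 0 < β) (hαβ : α + β = 1)
    {u v w : ℝ → ℝ≥0∞} (hu : Measurable u) (hv : Measurable v) (hw : Measurable w)
    (hA0 : ∫⁻ x in Ioi 0, u x ≠ 0) (hA : ∫⁻ x in Ioi 0, u x ≠ ⊤)
    (hB0 : ∫⁻ x in Ioi 0, v x ≠ 0) (hB : ∫⁻ x in Ioi 0, v x ≠ ⊤)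
    (hK0 : ∫⁻ t in Ioi 1, w t ≠ 0) (hK : ∫⁻ t in Ioi 1, w t ≠ ⊤) :
    ∫⁻ t in Ioi (1 : ℝ), w t *
        ∫⁻ x in Ioi 0, u x ^ α * (ENNReal.ofReal t * v (t * x)) ^ β
      < (∫⁻ t in Ioi 1, w t) * ((∫⁻ x in Ioi 0, u x) ^ α * (∫⁻ x in Ioi 0, v x) ^ β) := by
  set C := (∫⁻ x in Ioi 0, u x) ^ α * (∫⁻ x in Ioi 0, v x) ^ β
  set H : ℝ → ℝ≥0∞ := fun t => ∫⁻ x in Ioi 0, u x ^ α * (ENNReal.ofReal t * v (t * x)) ^ β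
  have hC : C ≠ ⊤ := ENNReal.mul_ne_top
    (ENNReal.rpow_ne_top_of_nonneg hα.le hA) (ENNReal.rpow_ne_top_of_nonneg hβ.le hB)
  have hHC : ∀ t : ℝ, 0 < t → H t ≤ C := by
    intro t ht
    have hconj : (1 / α).HolderConjugate (1 / β) := by
      rw [Real.holderConjugate_iff]
      refine ⟨(one_lt_div hα).2 (by linarith), by simpa using hαβ⟩
    have := ENNReal.lintegral_mul_le_Lp_mul_Lq (volume.restrict (Ioi (0 : ℝ))) hconj
      (f := fun x => u x ^ α) (g := fun x => (ENNReal.ofReal t * v (t * x)) ^ β)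
      (by fun_prop) (by fun_prop)
    simp only [Pi.mul_apply, ← ENNReal.rpow_mul, mul_one_div_cancel hα.ne',
      mul_one_div_cancel hβ.ne', ENNReal.rpow_one, one_div_one_div] at this
    rwa [lintegral_image_mul_left ht measurableSet_Ioi, image_mul_left_Ioi ht, mul_zero] at this
  have hle : ∀ᵐ t ∂volume.restrict (Ioi (1 : ℝ)), w t * H t ≤ w t * C :=
    (ae_restrict_mem measurableSet_Ioi).mono fun t ht => by
      gcongr; exact hHC t (one_pos.trans ht)
  have hwC : ∫⁻ t in Ioi 1, w t * C = (∫⁻ t in Ioi 1, w t) * C := lintegral_mul_const _ hw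
  rw [← hwC]
  refine lt_of_not_ge fun hge => hK0 ?_
  have hfin : ∫⁻ t in Ioi (1 : ℝ), w t * H t ≠ ⊤ :=
    ((lintegral_mono_ae hle).trans_lt (hwC ▸ ENNReal.mul_lt_top hK.lt_top hC.lt_top)).ne
  have hae := ae_eq_of_ae_le_of_lintegral_le hle hfin (by fun_prop) hge
  have hnull := compl_mem_ae_iff.2 ((subsingleton_dilations_holder_eq hα hβ hαβ hu hv
    hA0 hA hB0 hB).measure_zero (volume.restrict (Ioi (1 : ℝ))))
  rw [lintegral_eq_zero_iff hw]
  filter_upwards [hae, hnull, ae_lt_top hw hK, ae_restrict_mem measurableSet_Ioi]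
    with t h1 h2 h3 h4
  by_contra h0
  exact h2 ⟨one_pos.trans h4, (ENNReal.mul_right_inj h0 h3.ne).1 h1⟩

lemma lintegral_lower_triangle_eq_dilations {h : ℝ → ℝ → ℝ≥0∞}
    (hh : Measurable (Function.uncurry h)) :
    ∫⁻ y in Ioi (0 : ℝ), ∫⁻ x in Ioo 0 y, h x y
      = ∫⁻ t in Ioi (1 : ℝ), ∫⁻ x in Ioi (0 : ℝ), ENNReal.ofReal x * h x (x * t) := by
  have hm : MeasurableSet {z : ℝ × ℝ | z.2 < z.1} := measurableSet_lt measurable_snd measurable_fst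
  calc ∫⁻ y in Ioi (0 : ℝ), ∫⁻ x in Ioo 0 y, h x y
      = ∫⁻ y in Ioi (0 : ℝ), ∫⁻ x in Ioi (0 : ℝ),
          {z : ℝ × ℝ | z.2 < z.1}.indicator (fun z => h z.2 z.1) (y, x) := by
        refine lintegral_congr fun y => ?_
        rw [← Iio_inter_Ioi, ← Measure.restrict_restrict measurableSet_Iio,
          ← lintegral_indicator measurableSet_Iio]
        rfl
    _ = ∫⁻ x in Ioi (0 : ℝ), ∫⁻ y in Ioi (0 : ℝ),
          {z : ℝ × ℝ | z.2 < z.1}.indicator (fun z => h z.2 z.1) (y, x) :=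
        lintegral_lintegral_swap
          (((hh.comp measurable_swap).indicator hm).aemeasurable)
    _ = ∫⁻ x in Ioi (0 : ℝ), ∫⁻ t in Ioi (1 : ℝ), ENNReal.ofReal x * h x (x * t) := by
        refine setLIntegral_congr_fun measurableSet_Ioi fun x hx => ?_
        rw [lintegral_image_mul_left (mem_Ioi.1 hx) measurableSet_Ioi (fun y => h x y),
          image_mul_left_Ioi (mem_Ioi.1 hx), mul_one,
          ← Measure.restrict_restrict_of_subset (Ioi_subset_Ioi (le_of_lt (mem_Ioi.1 hx))),
          ← lintegral_indicator (s := Ioi x) measurableSet_Ioi]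
        rfl
    _ = _ := by
        refine lintegral_lintegral_swap (Measurable.aemeasurable ?_)
        exact (ENNReal.measurable_ofReal.comp measurable_fst).mul
          (hh.comp (measurable_fst.prodMk (measurable_fst.mul measurable_snd)))

lemma weighted_kernel_dilation_eq {p q mu σ x t a b c : ℝ} (hp : p ≠ 0) (hq : q ≠ 0)
    (hx : 0 < x) (ht : 0 < t) (ha : 0 ≤ a) (hb : 0 ≤ b) (hpq : 1 / p + 1 / q = 1) :
    x * (x ^ (-(mu + σ)) * c * a * b) = c * t ^ (σ - 1) *
      ((x ^ (p * (1 - mu) - 1) * a ^ p) ^ (1 / p) *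
        (t * ((t * x) ^ (q * (1 - σ) - 1) * b ^ q)) ^ (1 / q)) := by
  have hA : (x ^ (p * (1 - mu) - 1) * a ^ p) ^ (1 / p) = x ^ (1 - mu - 1 / p) * a := by
    rw [Real.mul_rpow (by positivity) (by positivity), ← Real.rpow_mul hx.le,
      ← Real.rpow_mul ha, mul_one_div_cancel hp, Real.rpow_one]
    congr 2
    field_simp
  have hB : (t * ((t * x) ^ (q * (1 - σ) - 1) * b ^ q)) ^ (1 / q)
      = t ^ (1 - σ) * x ^ (1 - σ - 1 / q) * b := by
    rw [Real.mul_rpow ht.le (by positivity), Real.mul_rpow (by positivity) (by positivity),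
      ← Real.rpow_mul (by positivity), ← Real.rpow_mul hb, mul_one_div_cancel hq, Real.rpow_one,
      show (q * (1 - σ) - 1) * (1 / q) = 1 - σ - 1 / q by field_simp,
      Real.mul_rpow ht.le hx.le, ← mul_assoc, ← mul_assoc, ← Real.rpow_add ht]
    congr 3
    ring
  have hT : t ^ (σ - 1) * t ^ (1 - σ) = 1 := by
    rw [← Real.rpow_add ht]; simp
  have hX : x ^ (1 - mu - 1 / p) * x ^ (1 - σ - 1 / q) = x * x ^ (-(mu + σ)) := by
    have hone := Real.rpow_add hx 1 (-(mu + σ))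
    rw [Real.rpow_one] at hone
    rw [← Real.rpow_add hx, ← hone]
    congr 1
    linarith
  rw [hA, hB]
  linear_combination (-(c * a * b) * t ^ (σ - 1) * t ^ (1 - σ)) * hX
    - (c * a * b * x * x ^ (-(mu + σ))) * hT

/-- Second-kind Hardy-type inequality with homogeneous kernel of degree `-λ`:
`∫₀^∞ (∫₀^y k_λ(x,y) f(x) dx) g(y) dy
  < k_λ⁽²⁾(σ) (∫₀^∞ x^{p(1-μ)-1} f^p)^{1/p} (∫₀^∞ y^{q(1-σ)-1} g^q)^{1/q}`,
where `k_λ⁽²⁾(σ) = ∫₁^∞ k_λ(1,t) t^{σ-1} dt`. -/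
theorem stmt14 (p q lam mu σ : ℝ) (hp : 1 < p) (hpq : 1 / p + 1 / q = 1)
    (hms : mu + σ = lam)
    (k : ℝ → ℝ → ℝ) (hkm : Measurable (Function.uncurry k))
    (hk0 : ∀ x y : ℝ, 0 < x → 0 < y → 0 ≤ k x y)
    (hhom : ∀ t x y : ℝ, 0 < t → 0 < x → 0 < y → k (t * x) (t * y) = t ^ (-lam) * k x y)
    (hK0 : 0 < ∫⁻ t in Ioi (1 : ℝ), ENNReal.ofReal (k 1 t * t ^ (σ - 1)))
    (hK1 : (∫⁻ t in Ioi (1 : ℝ), ENNReal.ofReal (k 1 t * t ^ (σ - 1))) < ⊤)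
    (f g : ℝ → ℝ) (hf : Measurable f) (hg : Measurable g)
    (hf0 : ∀ x ∈ Ioi (0 : ℝ), 0 ≤ f x) (hg0 : ∀ y ∈ Ioi (0 : ℝ), 0 ≤ g y)
    (hA0 : 0 < ∫⁻ x in Ioi (0 : ℝ), ENNReal.ofReal (x ^ (p * (1 - mu) - 1) * f x ^ p))
    (hA1 : (∫⁻ x in Ioi (0 : ℝ), ENNReal.ofReal (x ^ (p * (1 - mu) - 1) * f x ^ p)) < ⊤)
    (hB0 : 0 < ∫⁻ y in Ioi (0 : ℝ), ENNReal.ofReal (y ^ (q * (1 - σ) - 1) * g y ^ q))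
    (hB1 : (∫⁻ y in Ioi (0 : ℝ), ENNReal.ofReal (y ^ (q * (1 - σ) - 1) * g y ^ q)) < ⊤) :
    (∫⁻ y in Ioi (0 : ℝ),
        (∫⁻ x in Ioo (0 : ℝ) y, ENNReal.ofReal (k x y * f x)) * ENNReal.ofReal (g y))
      < (∫⁻ t in Ioi (1 : ℝ), ENNReal.ofReal (k 1 t * t ^ (σ - 1))) *
          (∫⁻ x in Ioi (0 : ℝ), ENNReal.ofReal (x ^ (p * (1 - mu) - 1) * f x ^ p)) ^ (1 / p) *
          (∫⁻ y in Ioi (0 : ℝ), ENNReal.ofReal (y ^ (q * (1 - σ) - 1) * g y ^ q)) ^ (1 / q) := by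
  have hp0 : 0 < p := by linarith
  have hα : 0 < 1 / p := by positivity
  have hβ : 0 < 1 / q := by
    have := (div_lt_one hp0).2 hp
    linarith
  have hq0 : 0 < q := one_div_pos.1 hβ
  have hmain := lintegral_dilations_lt hα hβ hpq
    (u := fun x => ENNReal.ofReal (x ^ (p * (1 - mu) - 1) * f x ^ p))
    (v := fun y => ENNReal.ofReal (y ^ (q * (1 - σ) - 1) * g y ^ q))
    (w := fun t => ENNReal.ofReal (k 1 t * t ^ (σ - 1)))
    (by fun_prop) (by fun_prop)
    (ENNReal.measurable_ofReal.comp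
      ((hkm.comp measurable_prodMk_left).mul (by fun_prop)))
    hA0.ne' hA1.ne hB0.ne' hB1.ne hK0.ne' hK1.ne
  rw [← mul_assoc] at hmain
  refine lt_of_eq_of_lt ?_ hmain
  have hkf : Measurable (Function.uncurry fun x y =>
      ENNReal.ofReal (k x y * f x) * ENNReal.ofReal (g y)) :=
    (ENNReal.measurable_ofReal.comp (hkm.mul (hf.comp measurable_fst))).mul
      (ENNReal.measurable_ofReal.comp (hg.comp measurable_snd))
  calc _ = ∫⁻ y in Ioi (0 : ℝ), ∫⁻ x in Ioo (0 : ℝ) y,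
        ENNReal.ofReal (k x y * f x) * ENNReal.ofReal (g y) :=
        lintegral_congr fun y => (lintegral_mul_const' _ _ ENNReal.ofReal_ne_top).symm
    _ = _ := lintegral_lower_triangle_eq_dilations hkf
    _ = _ := ?_
  refine setLIntegral_congr_fun measurableSet_Ioi fun t ht => ?_
  have ht0 : 0 < t := one_pos.trans ht
  rw [← lintegral_const_mul' _ _ ENNReal.ofReal_ne_top]
  refine setLIntegral_congr_fun measurableSet_Ioi fun x hx => ?_
  have hx0 : 0 < x := hx
  have ha := hf0 x hx
  have hb := hg0 (t * x) (mul_pos ht0 hx0)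
  have hk1 := hk0 1 t one_pos ht0
  have hhom' := hhom x 1 t hx0 one_pos ht0
  rw [mul_one, ← hms] at hhom'
  have hid := weighted_kernel_dilation_eq (mu := mu) (σ := σ) (c := k 1 t)
    hp0.ne' hq0.ne' hx0 ht0 ha hb hpq
  have hkx := hk0 x (x * t) hx0 (mul_pos hx0 ht0)
  rw [ENNReal.ofReal_rpow_of_nonneg (by positivity) hα.le, ← ENNReal.ofReal_mul ht0.le,
    ENNReal.ofReal_rpow_of_nonneg (by positivity) hβ.le, ← ENNReal.ofReal_mul (by positivity),
    ← ENNReal.ofReal_mul hx0.le, ← ENNReal.ofReal_mul (by positivity),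
    ← ENNReal.ofReal_mul (by positivity), ← hid, hhom', mul_comm x t]
end

section
/- Let p > 1 and let q satisfy 1/p + 1/q = 1, let σ ∈ ℝ, let δ ∈ {−1, 1}, and let H be a nonnegative Lebesgue-measurable function on ℝ with K(σ) := ∫_{−∞}^{∞} H(t) |t|^{σ-1} dt satisfying 0 < K(σ) < ∞. Let f, g be nonnegative measurable functions on ℝ such that 0 < ∫_{−∞}^{∞} |x|^{p(1−δσ)−1} f(x)^p dx < ∞ and 0 < ∫_{−∞}^{∞} |y|^{q(1−σ)−1} g(y)^q dy < ∞. Then ∫_{−∞}^{∞} ∫_{−∞}^{∞} H(x^δ · y) f(x) g(y) dx dy < K(σ) · (∫_{−∞}^{∞} |x|^{p(1−δσ)−1} f(x)^p dx)^{1/p} · (∫_{−∞}^{∞} |y|^{q(1−σ)−1} g(y)^q dy)^{1/q}. -/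
open MeasureTheory Set

open scoped ENNReal

/-- Equality case of Hölder's inequality for `ℝ≥0∞`-valued functions. -/
theorem ae_eq_of_lintegral_rpow_mul_rpow_eq {α : Type*} [MeasurableSpace α] {μ : Measure α}
    {p q : ℝ} (hpq : p.HolderConjugate q) {P Q : α → ℝ≥0∞} (hP : Measurable P) (hQ : Measurable Q)
    (hP0 : ∫⁻ x, P x ∂μ ≠ 0) (hPt : ∫⁻ x, P x ∂μ ≠ ∞)
    (hQ0 : ∫⁻ x, Q x ∂μ ≠ 0) (hQt : ∫⁻ x, Q x ∂μ ≠ ∞)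
    (h : ∫⁻ x, P x ^ (1 / p) * Q x ^ (1 / q) ∂μ
      = (∫⁻ x, P x ∂μ) ^ (1 / p) * (∫⁻ x, Q x ∂μ) ^ (1 / q)) :
    ∀ᵐ x ∂μ, P x / (∫⁻ x, P x ∂μ) = Q x / (∫⁻ x, Q x ∂μ) := by
  set A := ∫⁻ x, P x ∂μ with hA
  set B := ∫⁻ x, Q x ∂μ with hB
  have hp0 : 0 < p := hpq.pos
  have hq0 : 0 < q := hpq.symm.pos
  have hp' : (0 : ℝ) ≤ 1 / p := by positivity
  have hq' : (0 : ℝ) ≤ 1 / q := by positivity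
  have hA0 : A ^ (1 / p) ≠ 0 := (ENNReal.rpow_pos (pos_iff_ne_zero.2 hP0) hPt).ne'
  have hAt : A ^ (1 / p) ≠ ∞ := ENNReal.rpow_ne_top_of_nonneg hp' hPt
  have hB0 : B ^ (1 / q) ≠ 0 := (ENNReal.rpow_pos (pos_iff_ne_zero.2 hQ0) hQt).ne'
  have hBt : B ^ (1 / q) ≠ ∞ := ENNReal.rpow_ne_top_of_nonneg hq' hQt
  have key : (fun x => (P x / A) ^ (1 / p) * (Q x / B) ^ (1 / q)) =ᵐ[μ]
      fun x => P x / A / ENNReal.ofReal p + Q x / B / ENNReal.ofReal q := by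
    have hprod : ∀ x, (P x / A) ^ (1 / p) * (Q x / B) ^ (1 / q)
        = (P x ^ (1 / p) * Q x ^ (1 / q)) * (A ^ (1 / p) * B ^ (1 / q))⁻¹ := by
      intro x
      rw [ENNReal.div_rpow_of_nonneg _ _ hp', ENNReal.div_rpow_of_nonneg _ _ hq',
        ENNReal.mul_inv (Or.inl hA0) (Or.inl hAt)]
      simp only [div_eq_mul_inv]
      ring
    have hone : ∫⁻ x, (P x / A) ^ (1 / p) * (Q x / B) ^ (1 / q) ∂μ = 1 := by
      simp_rw [hprod]
      rw [lintegral_mul_const _ (by fun_prop), h]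
      exact ENNReal.mul_inv_cancel (mul_ne_zero hA0 hB0) (ENNReal.mul_ne_top hAt hBt)
    have hsum : ∫⁻ x, P x / A / ENNReal.ofReal p + Q x / B / ENNReal.ofReal q ∂μ = 1 := by
      rw [lintegral_add_left (by fun_prop)]
      simp only [div_eq_mul_inv]
      rw [lintegral_mul_const _ (by fun_prop), lintegral_mul_const _ (by fun_prop),
        lintegral_mul_const _ (by fun_prop), lintegral_mul_const _ (by fun_prop),
        ← hA, ← hB, ENNReal.mul_inv_cancel hP0 hPt, ENNReal.mul_inv_cancel hQ0 hQt]
      simpa using hpq.inv_add_inv_ennreal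
    refine ae_eq_of_ae_le_of_lintegral_le (ae_of_all _ fun x => ?_) (by rw [hone]; exact ENNReal.one_ne_top)
      (by fun_prop) (by rw [hone, hsum])
    have := ENNReal.young_inequality ((P x / A) ^ (1 / p)) ((Q x / B) ^ (1 / q)) hpq
    rwa [← ENNReal.rpow_mul, ← ENNReal.rpow_mul, one_div_mul_cancel hp0.ne',
      one_div_mul_cancel hq0.ne', ENNReal.rpow_one, ENNReal.rpow_one] at this
  have hPfin : ∀ᵐ x ∂μ, P x < ∞ := ae_lt_top hP hPt
  have hQfin : ∀ᵐ x ∂μ, Q x < ∞ := ae_lt_top hQ hQt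
  filter_upwards [key, hPfin, hQfin] with x hx hPx hQx
  have h1 := ENNReal.young_inequality_eq_iff ((P x / A) ^ (1 / p)) ((Q x / B) ^ (1 / q)) hpq
  rw [← ENNReal.rpow_mul, ← ENNReal.rpow_mul, one_div_mul_cancel hp0.ne',
    one_div_mul_cancel hq0.ne', ENNReal.rpow_one, ENNReal.rpow_one] at h1
  rcases h1.1 hx with ⟨h2, -⟩ | ⟨-, h2⟩ | h2
  · exact absurd h2 (ENNReal.rpow_ne_top_of_nonneg hp' (ENNReal.div_ne_top hPx.ne hP0))
  · exact absurd h2 (ENNReal.rpow_ne_top_of_nonneg hq' (ENNReal.div_ne_top hQx.ne hQ0))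
  · exact h2

/-- Change of variables `y = t * x ^ e` with `e = ±1` on the real line. -/
theorem lintegral_eq_lintegral_mul_zpow {e : ℤ} (he : e = -1 ∨ e = 1) {t : ℝ} (ht : t ≠ 0)
    (h : ℝ → ℝ≥0∞) :
    ∫⁻ y, h y = ∫⁻ x, ENNReal.ofReal (|t| * |x| ^ (e - 1)) * h (t * x ^ e) := by
  have hres : ∀ k : ℝ → ℝ≥0∞, ∫⁻ x, k x = ∫⁻ x in ({0}ᶜ : Set ℝ), k x := fun k => by
    rw [restrict_compl_singleton]
  have hinv : ∀ x : ℝ, (x ^ e) ^ e = x := by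
    rcases he with rfl | rfl <;> simp
  have himg : (fun x : ℝ => t * x ^ e) '' {0}ᶜ = {0}ᶜ := by
    ext y
    simp only [mem_image, mem_compl_iff, mem_singleton_iff]
    constructor
    · rintro ⟨x, hx, rfl⟩
      exact mul_ne_zero ht (zpow_ne_zero _ hx)
    · intro hy
      refine ⟨(y / t) ^ e, zpow_ne_zero _ (div_ne_zero hy ht), ?_⟩
      rw [hinv, mul_div_cancel₀ _ ht]
  have hinj : InjOn (fun x : ℝ => t * x ^ e) {0}ᶜ := by
    intro x _ y _ hxy
    have := mul_left_cancel₀ ht hxy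
    rw [← hinv x, this, hinv]
  have he1 : |(e : ℝ)| = 1 := by rcases he with rfl | rfl <;> simp
  have := lintegral_image_eq_lintegral_abs_deriv_mul (s := {0}ᶜ)
    (f := fun x : ℝ => t * x ^ e) (f' := fun x => t * (e * x ^ (e - 1)))
    (measurableSet_singleton _).compl
    (fun x hx => ((hasDerivAt_zpow e x (Or.inl hx)).const_mul t).hasDerivWithinAt) hinj h
  rw [himg] at this
  rw [hres h, this, hres]
  simp only [abs_mul, abs_zpow, he1, one_mul]

/-- Splitting of the integrand `f x * g y * |x| ^ e` with `y = t * x ^ e`, `e = -δ`, into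
Hölder factors. -/
theorem ofReal_mul_eq_rpow_mul_rpow {p q σ : ℝ} (hpq : p.HolderConjugate q) {δ : ℤ}
    {x t a b : ℝ} (hx : x ≠ 0) (ht : t ≠ 0) (ha : 0 ≤ a) (hb : 0 ≤ b) :
    ENNReal.ofReal (a * b * |x| ^ (-δ)) = ENNReal.ofReal (|t| ^ (σ - 1)) *
      (ENNReal.ofReal (|x| ^ (p * (1 - (δ : ℝ) * σ) - 1) * a ^ p) ^ (1 / p) *
        (ENNReal.ofReal (|t| * |x| ^ (-δ - 1)) *
          ENNReal.ofReal (|t * x ^ (-δ)| ^ (q * (1 - σ) - 1) * b ^ q)) ^ (1 / q)) := by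
  have hp0 : 0 < p := hpq.pos
  have hq0 : 0 < q := hpq.symm.pos
  have hX : 0 < |x| := abs_pos.2 hx
  have hT : 0 < |t| := abs_pos.2 ht
  have hsum : p⁻¹ + q⁻¹ = 1 := hpq.inv_add_inv_eq_one
  rw [abs_mul, abs_zpow]
  generalize |x| = X at *
  generalize |t| = T at *
  rw [← ENNReal.ofReal_mul (by positivity), ENNReal.ofReal_rpow_of_nonneg (by positivity)
    (by positivity), ENNReal.ofReal_rpow_of_nonneg (by positivity) (by positivity),
    ← ENNReal.ofReal_mul (by positivity), ← ENNReal.ofReal_mul (by positivity)]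
  congr 1
  have h1 : (X ^ (p * (1 - (δ : ℝ) * σ) - 1) * a ^ p) ^ (1 / p)
      = X ^ ((p * (1 - (δ : ℝ) * σ) - 1) * (1 / p)) * a := by
    rw [Real.mul_rpow (by positivity) (by positivity), ← Real.rpow_mul hX.le,
      ← Real.rpow_mul ha, mul_one_div_cancel hp0.ne', Real.rpow_one]
  have h2 : (T * X ^ (-δ - 1) * ((T * X ^ (-δ)) ^ (q * (1 - σ) - 1) * b ^ q)) ^ (1 / q)
      = T ^ (1 - σ) * X ^ ((-(δ : ℝ) - 1 - δ * (q * (1 - σ) - 1)) * (1 / q)) * b := by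
    have h3 : T * X ^ (-δ - 1) * ((T * X ^ (-δ)) ^ (q * (1 - σ) - 1) * b ^ q)
        = T ^ (q * (1 - σ)) * X ^ (-(δ : ℝ) - 1 - δ * (q * (1 - σ) - 1)) * b ^ q := by
      rw [Real.mul_rpow hT.le (by positivity), ← Real.rpow_intCast X (-δ),
        ← Real.rpow_intCast X (-δ - 1), ← Real.rpow_mul hX.le, Real.rpow_sub_one hT.ne',
        sub_eq_add_neg (-(δ : ℝ) - 1), Real.rpow_add hX]
      push_cast
      field_simp
    rw [h3, Real.mul_rpow (by positivity) (by positivity),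
      Real.mul_rpow (by positivity) (by positivity), ← Real.rpow_mul hX.le,
      ← Real.rpow_mul hT.le, ← Real.rpow_mul hb, mul_one_div_cancel hq0.ne', Real.rpow_one]
    congr 3
    field_simp
  rw [h1, h2, ← Real.rpow_intCast X (-δ)]
  have hXe : X ^ (((-δ : ℤ)) : ℝ) = X ^ ((p * (1 - (δ : ℝ) * σ) - 1) * (1 / p)) *
      X ^ ((-(δ : ℝ) - 1 - δ * (q * (1 - σ) - 1)) * (1 / q)) := by
    rw [← Real.rpow_add hX]
    congr 1
    have e1 : (p * (1 - (δ : ℝ) * σ) - 1) * (1 / p) = 1 - δ * σ - p⁻¹ := by field_simp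
    have e2 : (-(δ : ℝ) - 1 - δ * (q * (1 - σ) - 1)) * (1 / q) = -q⁻¹ - δ * (1 - σ) := by
      field_simp
      ring
    rw [e1, e2]
    push_cast
    linear_combination hsum
  have hTe : T ^ (σ - 1) * T ^ (1 - σ) = 1 := by
    rw [← Real.rpow_add hT]
    simp
  rw [hXe]
  linear_combination (-(X ^ ((p * (1 - (δ : ℝ) * σ) - 1) * (1 / p)) *
      X ^ ((-(δ : ℝ) - 1 - δ * (q * (1 - σ) - 1)) * (1 / q)) * a * b)) * hTe

/-- Whole-plane Yang–Hilbert-type inequality with non-homogeneous kernel `H(x^δ y)`: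
`∫_ℝ∫_ℝ H(x^δ y) f(x) g(y) dx dy
  < K(σ) (∫_ℝ |x|^{p(1-δσ)-1} f^p)^{1/p} (∫_ℝ |y|^{q(1-σ)-1} g^q)^{1/q}`. -/
theorem stmt16 (p q σ : ℝ) (hp : 1 < p) (hpq : 1 / p + 1 / q = 1)
    (δ : ℤ) (hδ : δ = -1 ∨ δ = 1)
    (H : ℝ → ℝ) (hH : Measurable H) (hH0 : ∀ t : ℝ, 0 ≤ H t)
    (hK0 : 0 < ∫⁻ t : ℝ, ENNReal.ofReal (H t * |t| ^ (σ - 1)))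
    (hK1 : (∫⁻ t : ℝ, ENNReal.ofReal (H t * |t| ^ (σ - 1))) < ⊤)
    (f g : ℝ → ℝ) (hf : Measurable f) (hg : Measurable g)
    (hf0 : ∀ x : ℝ, 0 ≤ f x) (hg0 : ∀ y : ℝ, 0 ≤ g y)
    (hA0 : 0 < ∫⁻ x : ℝ, ENNReal.ofReal (|x| ^ (p * (1 - (δ : ℝ) * σ) - 1) * f x ^ p))
    (hA1 : (∫⁻ x : ℝ, ENNReal.ofReal (|x| ^ (p * (1 - (δ : ℝ) * σ) - 1) * f x ^ p)) < ⊤)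
    (hB0 : 0 < ∫⁻ y : ℝ, ENNReal.ofReal (|y| ^ (q * (1 - σ) - 1) * g y ^ q))
    (hB1 : (∫⁻ y : ℝ, ENNReal.ofReal (|y| ^ (q * (1 - σ) - 1) * g y ^ q)) < ⊤) :
    (∫⁻ y : ℝ, ∫⁻ x : ℝ, ENNReal.ofReal (H (x ^ δ * y) * f x * g y))
      < (∫⁻ t : ℝ, ENNReal.ofReal (H t * |t| ^ (σ - 1))) *
          (∫⁻ x : ℝ, ENNReal.ofReal (|x| ^ (p * (1 - (δ : ℝ) * σ) - 1) * f x ^ p)) ^ (1 / p) *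
          (∫⁻ y : ℝ, ENNReal.ofReal (|y| ^ (q * (1 - σ) - 1) * g y ^ q)) ^ (1 / q) := by
  have hpq' : p.HolderConjugate q :=
    Real.holderConjugate_iff.2 ⟨hp, by simpa [one_div] using hpq⟩
  have hp0 : 0 < p := hpq'.pos
  have hq0 : 0 < q := hpq'.symm.pos
  set e : ℤ := -δ with he_def
  have he : e = -1 ∨ e = 1 := by omega
  set F : ℝ → ℝ≥0∞ :=
    fun x => ENNReal.ofReal (|x| ^ (p * (1 - (δ : ℝ) * σ) - 1) * f x ^ p) with hF
  set G : ℝ → ℝ≥0∞ := fun y => ENNReal.ofReal (|y| ^ (q * (1 - σ) - 1) * g y ^ q) with hG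
  have hFm : Measurable F := by fun_prop
  have hGm : Measurable G := by fun_prop
  set A := ∫⁻ x, F x with hA
  set B := ∫⁻ y, G y with hB
  let Q : ℝ → ℝ → ℝ≥0∞ := fun t x => ENNReal.ofReal (|t| * |x| ^ (e - 1)) * G (t * x ^ e)
  have hQm : ∀ t, Measurable (Q t) := fun t => by fun_prop
  have hQB : ∀ t ≠ 0, ∫⁻ x, Q t x = B := fun t ht =>
    (lintegral_eq_lintegral_mul_zpow he ht G).symm
  let J : ℝ → ℝ≥0∞ := fun t => ∫⁻ x, ENNReal.ofReal (f x * g (t * x ^ e) * |x| ^ e)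
  have hJm : Measurable J := by
    apply Measurable.lintegral_prod_right'
      (f := fun z : ℝ × ℝ => ENNReal.ofReal (f z.2 * g (z.1 * z.2 ^ e) * |z.2| ^ e))
    fun_prop
  have hJ : ∀ t ≠ 0, J t
      = ENNReal.ofReal (|t| ^ (σ - 1)) * ∫⁻ x, F x ^ (1 / p) * Q t x ^ (1 / q) := by
    intro t ht
    rw [← lintegral_const_mul _ (by fun_prop)]
    refine lintegral_congr_ae ?_
    filter_upwards [Measure.ae_ne volume (0 : ℝ)] with x hx
    exact ofReal_mul_eq_rpow_mul_rpow hpq' hx ht (hf0 x) (hg0 _)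
  have hJle : ∀ t ≠ 0, J t ≤ ENNReal.ofReal (|t| ^ (σ - 1)) * (A ^ (1 / p) * B ^ (1 / q)) := by
    intro t ht
    rw [hJ t ht, ← hQB t ht]
    gcongr
    exact ENNReal.lintegral_mul_norm_pow_le hFm.aemeasurable (hQm t).aemeasurable
      (by positivity) (by positivity) hpq
  have hJeq : ∀ t ≠ 0, J t = ENNReal.ofReal (|t| ^ (σ - 1)) * (A ^ (1 / p) * B ^ (1 / q)) →
      ∀ᵐ x, Q t x = B / A * F x := by
    intro t ht h
    have htp : 0 < |t| ^ (σ - 1) := Real.rpow_pos_of_pos (abs_pos.2 ht) _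
    rw [hJ t ht, ENNReal.mul_right_inj (by simpa using htp) ENNReal.ofReal_ne_top] at h
    have := ae_eq_of_lintegral_rpow_mul_rpow_eq hpq' hFm (hQm t) hA0.ne' hA1.ne
      (by rw [hQB t ht]; exact hB0.ne') (by rw [hQB t ht]; exact hB1.ne)
      (by rw [hQB t ht]; exact h)
    rw [hQB t ht] at this
    filter_upwards [this] with x hx
    rw [← ENNReal.div_mul_cancel (a := B) (b := Q t x) hB0.ne' hB1.ne, ← hx]
    simp only [div_eq_mul_inv]
    ring
  -- The bounded weight `|y| / (1 + |y|)` is strictly increasing in `|y|`.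
  let φ : ℝ → ℝ := fun y => |y| / (1 + |y|)
  have hφ : ∀ y z : ℝ, |y| < |z| → φ y < φ z := fun y z h => by
    have hy := abs_nonneg y
    simp only [φ]
    rw [div_lt_div_iff₀ (by linarith) (by linarith)]
    nlinarith
  have hφm : Measurable φ := by fun_prop
  have hφ1 : ∀ y, φ y ≤ 1 := fun y => by
    have hy := abs_nonneg y
    exact div_le_one_of_le₀ (by linarith) (by linarith)
  have hφ0 : ∀ y, 0 ≤ φ y := fun y => by positivity
  have hweight : ∀ t ≠ 0, J t = ENNReal.ofReal (|t| ^ (σ - 1)) * (A ^ (1 / p) * B ^ (1 / q)) →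
      ∫⁻ y, ENNReal.ofReal (φ y) * G y
        = B / A * ∫⁻ x, ENNReal.ofReal (φ (t * x ^ e)) * F x := by
    intro t ht h
    rw [lintegral_eq_lintegral_mul_zpow he ht, ← lintegral_const_mul _ (by fun_prop)]
    refine lintegral_congr_ae ?_
    filter_upwards [hJeq t ht h] with x hx
    rw [mul_left_comm]
    change _ * Q t x = _
    rw [hx]
    ring
  have hlt : ∀ s t : ℝ, s ≠ 0 → t ≠ 0 → |s| < |t| →
      ∫⁻ x, ENNReal.ofReal (φ (s * x ^ e)) * F x
        < ∫⁻ x, ENNReal.ofReal (φ (t * x ^ e)) * F x := by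
    intro s t hs ht hst
    have hφlt : ∀ x : ℝ, x ≠ 0 → φ (s * x ^ e) < φ (t * x ^ e) := fun x hx => by
      apply hφ
      rw [abs_mul, abs_mul]
      exact mul_lt_mul_of_pos_right hst (abs_pos.2 (zpow_ne_zero _ hx))
    refine lintegral_strict_mono_of_ae_le_of_ae_lt_on (s := {x | F x ≠ 0}) (by fun_prop)
      (ne_top_of_le_ne_top hA1.ne (lintegral_mono fun x => ?_)) ?_ ?_ ?_
    · exact mul_le_of_le_one_left zero_le (ENNReal.ofReal_le_one.2 (hφ1 _))
    · filter_upwards [Measure.ae_ne volume (0 : ℝ)] with x hx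
      gcongr
      exact (hφlt x hx).le
    · intro h0
      exact hA0.ne' ((lintegral_eq_zero_iff hFm).2 (ae_iff.2 h0))
    · filter_upwards [Measure.ae_ne volume (0 : ℝ)] with x hx hFx
      refine (ENNReal.mul_lt_mul_iff_left hFx ENNReal.ofReal_ne_top).2 ?_
      exact (ENNReal.ofReal_lt_ofReal_iff_of_nonneg (hφ0 _)).2 (hφlt x hx)
  have hBA0 : B / A ≠ 0 := by simp [ENNReal.div_eq_zero_iff, hB0.ne', hA1.ne]
  have hBAt : B / A ≠ ∞ := ENNReal.div_ne_top hB1.ne hA0.ne'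
  have habs : ∀ s t : ℝ, s ≠ 0 → t ≠ 0 →
      J s = ENNReal.ofReal (|s| ^ (σ - 1)) * (A ^ (1 / p) * B ^ (1 / q)) →
      J t = ENNReal.ofReal (|t| ^ (σ - 1)) * (A ^ (1 / p) * B ^ (1 / q)) → |s| = |t| := by
    intro s t hs ht hJs hJt
    have h := (hweight s hs hJs).symm.trans (hweight t ht hJt)
    rw [ENNReal.mul_right_inj hBA0 hBAt] at h
    rcases lt_trichotomy |s| |t| with hst | hst | hst
    · exact absurd h (hlt s t hs ht hst).ne
    · exact hst
    · exact absurd h (hlt t s ht hs hst).ne'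
  have hJlt : ∀ᵐ t, J t < ENNReal.ofReal (|t| ^ (σ - 1)) * (A ^ (1 / p) * B ^ (1 / q)) := by
    by_cases hex : ∃ s : ℝ, s ≠ 0 ∧
        J s = ENNReal.ofReal (|s| ^ (σ - 1)) * (A ^ (1 / p) * B ^ (1 / q))
    · obtain ⟨s, hs, hJs⟩ := hex
      filter_upwards [Measure.ae_ne volume (0 : ℝ), Measure.ae_ne volume s,
        Measure.ae_ne volume (-s)] with t ht hts hts'
      refine (hJle t ht).lt_of_ne fun h => ?_
      rcases abs_eq_abs.1 (habs t s ht hs h hJs) with h' | h'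
      · exact hts h'
      · exact hts' h'
    · filter_upwards [Measure.ae_ne volume (0 : ℝ)] with t ht
      exact (hJle t ht).lt_of_ne fun h => hex ⟨t, ht, h⟩
  have hI : (∫⁻ y : ℝ, ∫⁻ x : ℝ, ENNReal.ofReal (H (x ^ δ * y) * f x * g y))
      = ∫⁻ t, ENNReal.ofReal (H t) * J t := by
    rw [lintegral_lintegral_swap (by fun_prop)]
    have hstep : ∀ᵐ x : ℝ, ∫⁻ y, ENNReal.ofReal (H (x ^ δ * y) * f x * g y)
        = ∫⁻ t, ENNReal.ofReal (H t) * ENNReal.ofReal (f x * g (t * x ^ e) * |x| ^ e) := by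
      filter_upwards [Measure.ae_ne volume (0 : ℝ)] with x hx
      rw [lintegral_eq_lintegral_mul_zpow (Or.inr rfl) (zpow_ne_zero e hx)]
      refine lintegral_congr fun t => ?_
      rw [← ENNReal.ofReal_mul (by positivity), ← ENNReal.ofReal_mul (hH0 t)]
      have hxx : x ^ δ * (x ^ e * t ^ (1 : ℤ)) = t := by
        rw [← mul_assoc, ← zpow_add₀ hx, he_def]
        simp
      rw [hxx, zpow_one, mul_comm (x ^ e) t, abs_zpow]
      congr 1
      simp
      ring
    rw [lintegral_congr_ae hstep, lintegral_lintegral_swap (by fun_prop)]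
    refine lintegral_congr fun t => ?_
    rw [lintegral_const_mul _ (by fun_prop)]
  have hKC : ∫⁻ t, ENNReal.ofReal (H t) *
        (ENNReal.ofReal (|t| ^ (σ - 1)) * (A ^ (1 / p) * B ^ (1 / q)))
      = (∫⁻ t : ℝ, ENNReal.ofReal (H t * |t| ^ (σ - 1))) * A ^ (1 / p) * B ^ (1 / q) := by
    rw [mul_assoc, ← lintegral_mul_const _ (by fun_prop)]
    refine lintegral_congr fun t => ?_
    rw [ENNReal.ofReal_mul (hH0 t), mul_assoc]
  have hle : (fun t => ENNReal.ofReal (H t) * J t) ≤ᵐ[volume] fun t => ENNReal.ofReal (H t) *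
        (ENNReal.ofReal (|t| ^ (σ - 1)) * (A ^ (1 / p) * B ^ (1 / q))) := by
    filter_upwards [hJlt] with t ht
    gcongr
  rw [hI, ← hKC]
  refine lintegral_strict_mono_of_ae_le_of_ae_lt_on (s := {t | ENNReal.ofReal (H t) ≠ 0})
    (by fun_prop) (ne_top_of_le_ne_top ?_ (lintegral_mono_ae hle)) hle ?_ ?_
  · rw [hKC]
    exact ENNReal.mul_ne_top (ENNReal.mul_ne_top hK1.ne
      (ENNReal.rpow_ne_top_of_nonneg (by positivity) hA1.ne))
      (ENNReal.rpow_ne_top_of_nonneg (by positivity) hB1.ne)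
  · intro h0
    refine hK0.ne' ((lintegral_eq_zero_iff (by fun_prop)).2 ?_)
    filter_upwards [ae_iff.2 h0] with t ht
    rw [ENNReal.ofReal_mul (hH0 t), ht, zero_mul, Pi.zero_apply]
  · filter_upwards [hJlt] with t ht hHt
    exact (ENNReal.mul_lt_mul_iff_right hHt ENNReal.ofReal_ne_top).2 ht
end

section
/- Let p > 1 and let q satisfy 1/p + 1/q = 1, let σ ∈ ℝ, let δ ∈ {−1, 1}, and let H be a nonnegative Lebesgue-measurable function on ℝ with K(σ) := ∫_{−∞}^{∞} H(t) |t|^{σ-1} dt satisfying 0 < K(σ) < ∞. Let f be a nonnegative measurable function on ℝ such that 0 < ∫_{−∞}^{∞} |x|^{p(1−δσ)−1} f(x)^p dx < ∞. Then ∫_{−∞}^{∞} |y|^{pσ−1} (∫_{−∞}^{∞} H(x^δ · y) f(x) dx)^p dy < K(σ)^p · ∫_{−∞}^{∞} |x|^{p(1−δσ)−1} f(x)^p dx. -/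
open MeasureTheory Set

/-- The measure `dx / |x|` on the line, invariant under nonzero dilations and under inversion. -/
noncomputable def dilationMeasure : Measure ℝ :=
  volume.withDensity fun x => ENNReal.ofReal |x|⁻¹

instance sigmaFinite_dilationMeasure : SigmaFinite dilationMeasure := by
  unfold dilationMeasure
  infer_instance

lemma dilationMeasure_absolutelyContinuous : dilationMeasure ≪ volume :=
  withDensity_absolutelyContinuous _ _

lemma ae_ne_zero_dilationMeasure : ∀ᵐ x ∂dilationMeasure, x ≠ 0 :=
  dilationMeasure_absolutelyContinuous.ae_le (Measure.ae_ne volume 0)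

lemma lintegral_dilationMeasure {g : ℝ → ENNReal} (hg : Measurable g) :
    ∫⁻ x, g x ∂dilationMeasure = ∫⁻ x, ENNReal.ofReal |x|⁻¹ * g x := by
  unfold dilationMeasure
  rw [lintegral_withDensity_eq_lintegral_mul _ (by fun_prop) hg]
  rfl

lemma measurePreserving_mul_left_dilationMeasure {a : ℝ} (ha : a ≠ 0) :
    MeasurePreserving (fun x : ℝ => a * x) dilationMeasure dilationMeasure := by
  refine ⟨by fun_prop, Measure.ext_of_lintegral _ fun g hg => ?_⟩
  rw [lintegral_map hg (by fun_prop), lintegral_dilationMeasure (by fun_prop),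
    lintegral_dilationMeasure hg]
  have h1 : ∫⁻ x, ENNReal.ofReal |x|⁻¹ * g x ∂(Measure.map (fun x => a * x) volume)
      = ENNReal.ofReal |a⁻¹| * ∫⁻ x, ENNReal.ofReal |x|⁻¹ * g x := by
    rw [Real.map_volume_mul_left ha, lintegral_smul_measure, smul_eq_mul]
  rw [lintegral_map (by fun_prop) (by fun_prop)] at h1
  have h2 : ∀ x : ℝ, ENNReal.ofReal |a * x|⁻¹ * g (a * x)
      = ENNReal.ofReal |a⁻¹| * (ENNReal.ofReal |x|⁻¹ * g (a * x)) := fun x => by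
    rw [abs_mul, mul_inv, abs_inv, ENNReal.ofReal_mul (by positivity), mul_assoc]
  simp_rw [h2] at h1
  rw [lintegral_const_mul _ (by fun_prop)] at h1
  refine (ENNReal.mul_right_inj ?_ ENNReal.ofReal_ne_top).1 h1
  simpa using ha

lemma measurePreserving_inv_dilationMeasure :
    MeasurePreserving (fun x : ℝ => x⁻¹) dilationMeasure dilationMeasure := by
  refine ⟨by fun_prop, Measure.ext_of_lintegral _ fun g hg => ?_⟩
  rw [lintegral_map hg (by fun_prop), lintegral_dilationMeasure (by fun_prop),
    lintegral_dilationMeasure hg]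
  have himg : (fun x : ℝ => x⁻¹) '' {0}ᶜ = {0}ᶜ := by
    ext x
    simp only [mem_image, mem_compl_iff, mem_singleton_iff]
    exact ⟨by rintro ⟨y, hy, rfl⟩; simpa using hy, fun h => ⟨x⁻¹, by simpa using h, inv_inv x⟩⟩
  have h := lintegral_image_eq_lintegral_abs_deriv_mul (s := {0}ᶜ) (f := fun x : ℝ => x⁻¹)
    (f' := fun x => -(x ^ 2)⁻¹) (measurableSet_singleton 0).compl
    (fun x hx => (hasDerivAt_inv hx).hasDerivWithinAt) inv_injective.injOn
    (fun x => ENNReal.ofReal |x|⁻¹ * g x)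
  have hres : volume.restrict ({0}ᶜ : Set ℝ) = volume :=
    Measure.restrict_eq_self_of_ae_mem (Measure.ae_ne volume 0)
  rw [himg, hres] at h
  rw [h]
  refine lintegral_congr_ae ?_
  filter_upwards [Measure.ae_ne volume (0 : ℝ)] with x hx
  rw [← mul_assoc, ← ENNReal.ofReal_mul (by positivity)]
  congr 2
  have : 0 < |x| := abs_pos.2 hx
  rw [abs_neg, abs_inv, abs_inv, abs_pow]
  field_simp

/-- A function that is integrable for `dx / |x|` and invariant under a dilation of ratio other than
`±1` vanishes almost everywhere. -/
lemma lintegral_eq_zero_of_dilation_invariant_s17 {g : ℝ → ENNReal} (hg : Measurable g)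
    (hfin : ∫⁻ x, g x ∂dilationMeasure ≠ ⊤) {a : ℝ} (ha : 1 < |a|)
    (hinv : ∀ᵐ x ∂dilationMeasure, g (a * x) = g x) :
    ∫⁻ x, g x ∂dilationMeasure = 0 := by
  have ha0 : a ≠ 0 := by rintro rfl; simp at ha; linarith
  have heq : ∫⁻ x, ENNReal.ofReal (1 + |a * x|)⁻¹ * g x ∂dilationMeasure
      = ∫⁻ x, ENNReal.ofReal (1 + |x|)⁻¹ * g x ∂dilationMeasure := by
    rw [← (measurePreserving_mul_left_dilationMeasure ha0).lintegral_comp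
      (f := fun x => ENNReal.ofReal (1 + |x|)⁻¹ * g x) (by fun_prop)]
    refine lintegral_congr_ae ?_
    filter_upwards [hinv] with x hx
    rw [hx]
  have hle : ∀ x : ℝ, |x| ≤ |a * x| := fun x => by
    rw [abs_mul]; nlinarith [abs_nonneg x]
  have hbound : ∫⁻ x, ENNReal.ofReal (1 + |a * x|)⁻¹ * g x ∂dilationMeasure ≠ ⊤ := by
    refine ne_top_of_le_ne_top hfin (lintegral_mono fun x => ?_)
    refine mul_le_of_le_one_left' (ENNReal.ofReal_le_one.2 (inv_le_one_of_one_le₀ ?_))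
    linarith [abs_nonneg (a * x)]
  have hae := ae_eq_of_ae_le_of_lintegral_le (Filter.Eventually.of_forall fun x => by
    have := hle x
    gcongr) hbound (by fun_prop) heq.ge
  rw [lintegral_eq_zero_iff hg]
  filter_upwards [hae, ae_lt_top hg hfin, ae_ne_zero_dilationMeasure] with x hx hxt hx0
  by_contra h0
  have h1 := (ENNReal.mul_left_inj h0 hxt.ne).1 hx
  rw [ENNReal.ofReal_eq_ofReal_iff (by positivity) (by positivity), inv_inj, abs_mul] at h1
  nlinarith [abs_pos.2 hx0]

lemma lintegral_rpow_le_measure_univ_mul {α : Type*} [MeasurableSpace α] (ν : Measure α)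
    {p : ℝ} (hp : 1 < p) {F : α → ENNReal} (hF : Measurable F) :
    (∫⁻ x, F x ∂ν) ^ p ≤ ν univ ^ (p - 1) * ∫⁻ x, F x ^ p ∂ν := by
  have hpq := Real.HolderConjugate.conjExponent hp
  have h := ENNReal.lintegral_mul_le_Lp_mul_Lq ν hpq hF.aemeasurable
    (aemeasurable_const (b := (1 : ENNReal)))
  simp only [Pi.mul_apply, mul_one, ENNReal.one_rpow, lintegral_const, one_mul] at h
  refine (ENNReal.rpow_le_rpow h (by linarith)).trans_eq ?_
  rw [ENNReal.mul_rpow_of_nonneg _ _ (by linarith), ← ENNReal.rpow_mul, ← ENNReal.rpow_mul,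
    mul_comm]
  have h1 : 1 / p * p = 1 := by field_simp
  have h2 : 1 / p.conjExponent * p = p - 1 := by
    unfold Real.conjExponent
    have : p - 1 ≠ 0 := by linarith
    field_simp
  rw [h1, h2, ENNReal.rpow_one]

lemma ae_eq_const_of_measure_univ_mul_le {α : Type*} [MeasurableSpace α] (ν : Measure α)
    [IsFiniteMeasure ν] (hν : ν univ ≠ 0) {p : ℝ} (hp : 1 < p) {F : α → ℝ} (hF : Measurable F)
    (hF0 : ∀ x, 0 ≤ F x) (hfin : ∫⁻ x, ENNReal.ofReal (F x ^ p) ∂ν ≠ ⊤)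
    (hle : ν univ ^ (p - 1) * ∫⁻ x, ENNReal.ofReal (F x ^ p) ∂ν
      ≤ (∫⁻ x, ENNReal.ofReal (F x) ∂ν) ^ p) :
    ∀ᵐ x ∂ν, F x = (∫⁻ x, ENNReal.ofReal (F x) ∂ν).toReal / (ν univ).toReal := by
  have hp0 : 0 < p := by linarith
  have hpow : ∀ x, ENNReal.ofReal (F x) ^ p = ENNReal.ofReal (F x ^ p) := fun x =>
    ENNReal.ofReal_rpow_of_nonneg (hF0 x) hp0.le
  have hFp0 : ∀ x, 0 ≤ F x ^ p := fun x => Real.rpow_nonneg (hF0 x) p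
  have hFpi : Integrable (fun x => F x ^ p) ν :=
    (lintegral_ofReal_ne_top_iff_integrable (hF.pow_const p).aestronglyMeasurable
      (ae_of_all _ hFp0)).1 hfin
  have h1 : ∫⁻ x, ENNReal.ofReal (F x) ∂ν ≠ ⊤ := by
    intro htop
    have := lintegral_rpow_le_measure_univ_mul ν hp (F := fun x => ENNReal.ofReal (F x))
      (by fun_prop)
    simp only [hpow, htop, ENNReal.top_rpow_of_pos hp0, top_le_iff] at this
    exact ENNReal.mul_ne_top (ENNReal.rpow_ne_top_of_nonneg (by linarith) (measure_ne_top ν _))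
      hfin this
  have hFi : Integrable F ν :=
    (lintegral_ofReal_ne_top_iff_integrable (by fun_prop) (ae_of_all _ hF0)).1 h1
  have hI : ∫ x, F x ∂ν = (∫⁻ x, ENNReal.ofReal (F x) ∂ν).toReal :=
    integral_eq_lintegral_of_nonneg_ae (ae_of_all _ hF0) hF.aestronglyMeasurable
  have hIp : ∫ x, F x ^ p ∂ν = (∫⁻ x, ENNReal.ofReal (F x ^ p) ∂ν).toReal :=
    integral_eq_lintegral_of_nonneg_ae (ae_of_all _ hFp0) hFpi.aestronglyMeasurable
  have havg : ⨍ x, F x ∂ν = (∫⁻ x, ENNReal.ofReal (F x) ∂ν).toReal / (ν univ).toReal := by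
    rw [average_eq, hI, smul_eq_mul, measureReal_def, inv_mul_eq_div]
  rcases (strictConvexOn_rpow hp).ae_eq_const_or_map_average_lt
    (continuousOn_id.rpow_const fun _ _ => Or.inr hp0.le) isClosed_Ici
    (ae_of_all ν hF0) hFi hFpi with h | h
  · filter_upwards [h] with x hx
    rw [hx, Function.const_apply, havg]
  · exfalso
    have hm : 0 < (ν univ).toReal := ENNReal.toReal_pos hν (measure_ne_top ν _)
    have hle' := ENNReal.toReal_mono (ENNReal.rpow_ne_top_of_nonneg hp0.le h1) hle
    rw [ENNReal.toReal_mul, ← ENNReal.toReal_rpow, ← ENNReal.toReal_rpow, ← hIp] at hle'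
    rw [havg, average_eq, smul_eq_mul, measureReal_def, Real.div_rpow (by positivity) hm.le,
      div_lt_iff₀ (by positivity)] at h
    have : (ν univ).toReal ^ p = (ν univ).toReal ^ (p - 1) * (ν univ).toReal := by
      rw [Real.rpow_sub_one hm.ne']; field_simp
    rw [this] at h
    have h3 : (ν univ).toReal⁻¹ * (∫ x, F x ^ p ∂ν) *
        ((ν univ).toReal ^ (p - 1) * (ν univ).toReal)
        = (ν univ).toReal ^ (p - 1) * ∫ x, F x ^ p ∂ν := by field_simp
    linarith

/-- An integrable nonnegative `F` with nonzero `p`-norm for `dx / |x|` cannot be almost everywhere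
constant on almost every dilate of a non-null set. -/
lemma not_ae_const_on_dilates {k F c : ℝ → ℝ} {p : ℝ} (hk : Measurable k) (hF : Measurable F)
    (hc : Measurable c) (hk0 : ¬ ∀ᵐ t ∂dilationMeasure, k t = 0)
    (hA0 : ∫⁻ x, ENNReal.ofReal (F x ^ p) ∂dilationMeasure ≠ 0)
    (hA1 : ∫⁻ x, ENNReal.ofReal (F x ^ p) ∂dilationMeasure ≠ ⊤) :
    ¬ ∀ᵐ y ∂dilationMeasure, ∀ᵐ x ∂dilationMeasure, k (x * y) ≠ 0 → F x = c y := by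
  intro h
  have h1 : ∀ᵐ y ∂dilationMeasure, ∀ᵐ t ∂dilationMeasure, k t ≠ 0 → F (y⁻¹ * t) = c y := by
    filter_upwards [h, ae_ne_zero_dilationMeasure] with y hy hy0
    filter_upwards [(measurePreserving_mul_left_dilationMeasure
      (inv_ne_zero hy0)).quasiMeasurePreserving.ae hy] with t ht hkt
    refine ht ?_
    rwa [mul_comm, mul_inv_cancel_left₀ hy0]
  have hmeas : MeasurableSet {z : ℝ × ℝ | k z.2 ≠ 0 → F (z.1⁻¹ * z.2) = c z.1} := by
    have e : {z : ℝ × ℝ | k z.2 ≠ 0 → F (z.1⁻¹ * z.2) = c z.1}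
        = {z : ℝ × ℝ | k z.2 = 0} ∪ {z : ℝ × ℝ | F (z.1⁻¹ * z.2) = c z.1} := by
      ext z; simp only [mem_ofPred_eq, mem_union]; tauto
    rw [e]
    exact (measurableSet_eq_fun (by fun_prop) (by fun_prop)).union
      (measurableSet_eq_fun (by fun_prop) (by fun_prop))
  have h2 := (Measure.ae_ae_comm (μ := dilationMeasure) (ν := dilationMeasure)
    (p := fun y t => k t ≠ 0 → F (y⁻¹ * t) = c y) hmeas).1 h1
  have hex : ∀ s : ℝ, ∃ t, t ≠ 0 ∧ t ≠ s ∧ t ≠ -s ∧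
      ∀ᵐ y ∂dilationMeasure, F (y⁻¹ * t) = c y := by
    intro s
    by_contra hcon
    apply hk0
    filter_upwards [h2, ae_ne_zero_dilationMeasure,
      dilationMeasure_absolutelyContinuous.ae_le (Measure.ae_ne volume s),
      dilationMeasure_absolutelyContinuous.ae_le (Measure.ae_ne volume (-s))] with t ht h0 hs hs'
    by_contra hkt
    refine hcon ⟨t, h0, hs, hs', ?_⟩
    filter_upwards [ht] with y hy using hy hkt
  obtain ⟨r, hr0, -, -, hr⟩ := hex 0
  obtain ⟨s, hs0, hsr, hsr', hs⟩ := hex r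
  have habs : |s| ≠ |r| := by
    rw [Ne, abs_eq_abs]; tauto
  have hratio : ∀ r s : ℝ, r ≠ 0 → |r| < |s| →
      (∀ᵐ y ∂dilationMeasure, F (y⁻¹ * r) = c y) →
      (∀ᵐ y ∂dilationMeasure, F (y⁻¹ * s) = c y) → False := by
    intro r s hr0 hlt hr hs
    refine hA0 (lintegral_eq_zero_of_dilation_invariant_s17 (a := s / r) (by fun_prop) hA1 ?_ ?_)
    · rw [abs_div, lt_div_iff₀ (abs_pos.2 hr0)]; linarith
    · have hmp := (measurePreserving_mul_left_dilationMeasure hr0).comp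
        measurePreserving_inv_dilationMeasure
      filter_upwards [hmp.quasiMeasurePreserving.ae hr,
        hmp.quasiMeasurePreserving.ae hs] with x hx hx'
      have e1 : (r * x⁻¹)⁻¹ * r = x := by field_simp
      have e2 : (r * x⁻¹)⁻¹ * s = s / r * x := by field_simp
      simp only [Function.comp_apply, e1] at hx
      simp only [Function.comp_apply, e2] at hx'
      rw [hx, hx']
  rcases lt_or_gt_of_ne habs with hl | hl
  · exact hratio s r hs0 hl hs hr
  · exact hratio r s hr0 hl hr hs

/-- Strict Young inequality for multiplicative convolution on the punctured line. -/
lemma lintegral_dilation_kernel_rpow_lt {k F : ℝ → ℝ} {p : ℝ} (hp : 1 < p)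
    (hk : Measurable k) (hF : Measurable F) (hF0 : ∀ x, 0 ≤ F x)
    (hK0 : ∫⁻ t, ENNReal.ofReal (k t) ∂dilationMeasure ≠ 0)
    (hK1 : ∫⁻ t, ENNReal.ofReal (k t) ∂dilationMeasure ≠ ⊤)
    (hA0 : ∫⁻ x, ENNReal.ofReal (F x ^ p) ∂dilationMeasure ≠ 0)
    (hA1 : ∫⁻ x, ENNReal.ofReal (F x ^ p) ∂dilationMeasure ≠ ⊤) :
    ∫⁻ y, (∫⁻ x, ENNReal.ofReal (k (x * y)) * ENNReal.ofReal (F x) ∂dilationMeasure) ^ p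
        ∂dilationMeasure
      < (∫⁻ t, ENNReal.ofReal (k t) ∂dilationMeasure) ^ p *
        ∫⁻ x, ENNReal.ofReal (F x ^ p) ∂dilationMeasure := by
  set K := ∫⁻ t, ENNReal.ofReal (k t) ∂dilationMeasure with hK
  set A := ∫⁻ x, ENNReal.ofReal (F x ^ p) ∂dilationMeasure with hA
  have hp0 : 0 < p := by linarith
  set G : ℝ → ENNReal := fun y =>
    ∫⁻ x, ENNReal.ofReal (k (x * y)) * ENNReal.ofReal (F x) ∂dilationMeasure with hG
  set B : ℝ → ENNReal := fun y =>
    ∫⁻ x, ENNReal.ofReal (k (x * y)) * ENNReal.ofReal (F x ^ p) ∂dilationMeasure with hB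
  have hGm : Measurable G := Measurable.lintegral_prod_right'
    (f := fun z : ℝ × ℝ => ENNReal.ofReal (k (z.2 * z.1)) * ENNReal.ofReal (F z.2)) (by fun_prop)
  have hBm : Measurable B := Measurable.lintegral_prod_right'
    (f := fun z : ℝ × ℝ => ENNReal.ofReal (k (z.2 * z.1)) * ENNReal.ofReal (F z.2 ^ p))
    (by fun_prop)
  have hmass : ∀ y : ℝ, y ≠ 0 → ∫⁻ x, ENNReal.ofReal (k (x * y)) ∂dilationMeasure = K := by
    intro y hy
    simp_rw [mul_comm _ y]
    exact (measurePreserving_mul_left_dilationMeasure hy).lintegral_comp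
      (f := fun t => ENNReal.ofReal (k t)) (by fun_prop)
  let ν : ℝ → Measure ℝ := fun y =>
    dilationMeasure.withDensity fun x => ENNReal.ofReal (k (x * y))
  have hν : ∀ y : ℝ, y ≠ 0 → ν y univ = K := fun y hy => by
    rw [withDensity_apply _ MeasurableSet.univ, Measure.restrict_univ, hmass y hy]
  have hνint : ∀ (y : ℝ) {g : ℝ → ENNReal}, Measurable g →
      ∫⁻ x, g x ∂ν y = ∫⁻ x, ENNReal.ofReal (k (x * y)) * g x ∂dilationMeasure := fun y g hg => by
    rw [lintegral_withDensity_eq_lintegral_mul _ (by fun_prop) hg]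
    rfl
  have hpt : ∀ y : ℝ, y ≠ 0 → G y ^ p ≤ K ^ (p - 1) * B y := by
    intro y hy
    have h := lintegral_rpow_le_measure_univ_mul (ν y) hp
      (F := fun x => ENNReal.ofReal (F x)) (by fun_prop)
    simp only [ENNReal.ofReal_rpow_of_nonneg (hF0 _) hp0.le] at h
    rwa [hν y hy, hνint y (by fun_prop), hνint y (by fun_prop)] at h
  have hBint : ∫⁻ y, B y ∂dilationMeasure = K * A := by
    rw [hB, lintegral_lintegral_swap (by fun_prop), hA, ← lintegral_const_mul _ (by fun_prop)]
    refine lintegral_congr_ae ?_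
    filter_upwards [ae_ne_zero_dilationMeasure] with x hx
    rw [lintegral_mul_const _ (by fun_prop)]
    congr 1
    exact (measurePreserving_mul_left_dilationMeasure hx).lintegral_comp
      (f := fun t => ENNReal.ofReal (k t)) (by fun_prop)
  have hKB : ∫⁻ y, K ^ (p - 1) * B y ∂dilationMeasure = K ^ p * A := by
    rw [lintegral_const_mul _ hBm, hBint, ← mul_assoc]
    congr 1
    conv_lhs => rw [← ENNReal.rpow_one K, ← ENNReal.rpow_mul, ← ENNReal.rpow_add _ _ hK0 hK1]
    norm_num
  by_contra! hcon
  have hptae : ∀ᵐ y ∂dilationMeasure, G y ^ p ≤ K ^ (p - 1) * B y := by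
    filter_upwards [ae_ne_zero_dilationMeasure] with y hy using hpt y hy
  have hfin : ∫⁻ y, G y ^ p ∂dilationMeasure ≠ ⊤ :=
    ne_top_of_le_ne_top (ENNReal.mul_ne_top (ENNReal.rpow_ne_top_of_nonneg hp0.le hK1) hA1)
      ((lintegral_mono_ae hptae).trans_eq hKB)
  have heq := ae_eq_of_ae_le_of_lintegral_le hptae hfin (by fun_prop) (hKB.trans_le hcon)
  have hBfin := ae_lt_top hBm (hBint ▸ ENNReal.mul_ne_top hK1 hA1)
  refine not_ae_const_on_dilates (k := fun t => max (k t) 0) (c := fun y => (G y).toReal / K.toReal)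
    (by fun_prop) hF (by fun_prop) ?_ hA0 hA1 ?_
  · intro h0
    refine hK0 ((lintegral_eq_zero_iff (by fun_prop)).2 ?_)
    filter_upwards [h0] with t ht
    simpa using ht
  · filter_upwards [heq, hBfin, ae_ne_zero_dilationMeasure] with y hy hyB hy0
    have : IsFiniteMeasure (ν y) := ⟨by rw [hν y hy0]; exact hK1.lt_top⟩
    have h := ae_eq_const_of_measure_univ_mul_le (ν y) (by rwa [hν y hy0]) hp hF hF0
      (by rw [hνint y (by fun_prop)]; exact hyB.ne)
      (by rw [hν y hy0, hνint y (by fun_prop), hνint y (by fun_prop)]; exact hy.ge)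
    rw [hν y hy0, hνint y (by fun_prop), ae_withDensity_iff (by fun_prop)] at h
    filter_upwards [h] with x hx hkx
    refine hx ?_
    simpa using hkx

/-- The version of `lintegral_dilation_kernel_rpow_lt` for the kernels `k (x * y)` and
`k (y / x)`. -/
lemma lintegral_dilation_kernel_zpow_rpow_lt {k F : ℝ → ℝ} {p : ℝ} (hp : 1 < p) {δ : ℤ}
    (hδ : δ = -1 ∨ δ = 1) (hk : Measurable k) (hF : Measurable F) (hF0 : ∀ x, 0 ≤ F x)
    (hK0 : ∫⁻ t, ENNReal.ofReal (k t) ∂dilationMeasure ≠ 0)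
    (hK1 : ∫⁻ t, ENNReal.ofReal (k t) ∂dilationMeasure ≠ ⊤)
    (hA0 : ∫⁻ x, ENNReal.ofReal (F x ^ p) ∂dilationMeasure ≠ 0)
    (hA1 : ∫⁻ x, ENNReal.ofReal (F x ^ p) ∂dilationMeasure ≠ ⊤) :
    ∫⁻ y, (∫⁻ x, ENNReal.ofReal (k (x ^ δ * y)) * ENNReal.ofReal (F x) ∂dilationMeasure) ^ p
        ∂dilationMeasure
      < (∫⁻ t, ENNReal.ofReal (k t) ∂dilationMeasure) ^ p *
        ∫⁻ x, ENNReal.ofReal (F x ^ p) ∂dilationMeasure := by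
  rcases hδ with rfl | rfl
  · have hA := measurePreserving_inv_dilationMeasure.lintegral_comp
      (f := fun x => ENNReal.ofReal (F x ^ p)) (by fun_prop)
    have h := lintegral_dilation_kernel_rpow_lt (F := fun x => F x⁻¹) hp hk (by fun_prop)
      (fun x => hF0 _) hK0 hK1 (by rwa [hA]) (by rwa [hA])
    rw [hA] at h
    refine lt_of_eq_of_lt (lintegral_congr fun y => ?_) h
    rw [← measurePreserving_inv_dilationMeasure.lintegral_comp (by fun_prop)]
    simp
  · simpa using lintegral_dilation_kernel_rpow_lt hp hk hF hF0 hK0 hK1 hA0 hA1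

/-- Whole-plane equivalent strict form:
`∫_ℝ |y|^{pσ-1} (∫_ℝ H(x^δ y) f(x) dx)^p dy < K(σ)^p ∫_ℝ |x|^{p(1-δσ)-1} f(x)^p dx`. -/
theorem stmt17 (p q σ : ℝ) (hp : 1 < p) (hpq : 1 / p + 1 / q = 1)
    (δ : ℤ) (hδ : δ = -1 ∨ δ = 1)
    (H : ℝ → ℝ) (hH : Measurable H) (hH0 : ∀ t : ℝ, 0 ≤ H t)
    (hK0 : 0 < ∫⁻ t : ℝ, ENNReal.ofReal (H t * |t| ^ (σ - 1)))
    (hK1 : (∫⁻ t : ℝ, ENNReal.ofReal (H t * |t| ^ (σ - 1))) < ⊤)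
    (f : ℝ → ℝ) (hf : Measurable f) (hf0 : ∀ x : ℝ, 0 ≤ f x)
    (hA0 : 0 < ∫⁻ x : ℝ, ENNReal.ofReal (|x| ^ (p * (1 - (δ : ℝ) * σ) - 1) * f x ^ p))
    (hA1 : (∫⁻ x : ℝ, ENNReal.ofReal (|x| ^ (p * (1 - (δ : ℝ) * σ) - 1) * f x ^ p)) < ⊤) :
    (∫⁻ y : ℝ,
        ENNReal.ofReal (|y| ^ (p * σ - 1)) *
          (∫⁻ x : ℝ, ENNReal.ofReal (H (x ^ δ * y) * f x)) ^ p)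
      < (∫⁻ t : ℝ, ENNReal.ofReal (H t * |t| ^ (σ - 1))) ^ p *
          ∫⁻ x : ℝ, ENNReal.ofReal (|x| ^ (p * (1 - (δ : ℝ) * σ) - 1) * f x ^ p) := by
  have hp0 : 0 < p := by linarith
  have hxδ : Measurable fun x : ℝ => x ^ δ := by
    rcases hδ with rfl | rfl <;> simp only [zpow_neg, zpow_one] <;> fun_prop
  set k : ℝ → ℝ := fun t => H t * |t| ^ σ with hk
  set F : ℝ → ℝ := fun x => |x| ^ (1 - (δ : ℝ) * σ) * f x with hF
  have hkm : Measurable k := by fun_prop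
  have hFm : Measurable F := by fun_prop
  have hF0 : ∀ x, 0 ≤ F x := fun x => mul_nonneg (by positivity) (hf0 x)
  have hKeq : ∫⁻ t : ℝ, ENNReal.ofReal (H t * |t| ^ (σ - 1))
      = ∫⁻ t, ENNReal.ofReal (k t) ∂dilationMeasure := by
    rw [lintegral_dilationMeasure (by fun_prop)]
    refine lintegral_congr_ae ?_
    filter_upwards [Measure.ae_ne volume (0 : ℝ)] with t ht
    rw [← ENNReal.ofReal_mul (by positivity), Real.rpow_sub_one (abs_ne_zero.2 ht)]
    congr 1
    simp only [hk]
    ring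
  have hAeq : ∫⁻ x : ℝ, ENNReal.ofReal (|x| ^ (p * (1 - (δ : ℝ) * σ) - 1) * f x ^ p)
      = ∫⁻ x, ENNReal.ofReal (F x ^ p) ∂dilationMeasure := by
    rw [lintegral_dilationMeasure (by fun_prop)]
    refine lintegral_congr_ae ?_
    filter_upwards [Measure.ae_ne volume (0 : ℝ)] with x hx
    rw [← ENNReal.ofReal_mul (by positivity), Real.rpow_sub_one (abs_ne_zero.2 hx)]
    congr 1
    simp only [hF]
    rw [Real.mul_rpow (by positivity) (hf0 x), ← Real.rpow_mul (abs_nonneg x),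
      mul_comm _ p]
    ring
  have hLeq : (∫⁻ y : ℝ, ENNReal.ofReal (|y| ^ (p * σ - 1)) *
          (∫⁻ x : ℝ, ENNReal.ofReal (H (x ^ δ * y) * f x)) ^ p)
      = ∫⁻ y, (∫⁻ x, ENNReal.ofReal (k (x ^ δ * y)) * ENNReal.ofReal (F x) ∂dilationMeasure) ^ p
        ∂dilationMeasure := by
    have hm : Measurable fun y => ∫⁻ x, ENNReal.ofReal (k (x ^ δ * y)) * ENNReal.ofReal (F x)
        ∂dilationMeasure := Measurable.lintegral_prod_right'
      (f := fun z : ℝ × ℝ => ENNReal.ofReal (k (z.2 ^ δ * z.1)) * ENNReal.ofReal (F z.2))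
      (by fun_prop)
    rw [lintegral_dilationMeasure (by fun_prop)]
    refine lintegral_congr_ae ?_
    filter_upwards [Measure.ae_ne volume (0 : ℝ)] with y hy
    have hy' : 0 < |y| := abs_pos.2 hy
    have hin : ∫⁻ x, ENNReal.ofReal (k (x ^ δ * y)) * ENNReal.ofReal (F x) ∂dilationMeasure
        = ENNReal.ofReal (|y| ^ σ) * ∫⁻ x : ℝ, ENNReal.ofReal (H (x ^ δ * y) * f x) := by
      rw [lintegral_dilationMeasure (by fun_prop), ← lintegral_const_mul _ (by fun_prop)]
      refine lintegral_congr_ae ?_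
      filter_upwards [Measure.ae_ne volume (0 : ℝ)] with x hx
      have hx' : 0 < |x| := abs_pos.2 hx
      rw [← ENNReal.ofReal_mul (mul_nonneg (hH0 _) (by positivity)),
        ← ENNReal.ofReal_mul (by positivity), ← ENNReal.ofReal_mul (by positivity)]
      congr 1
      simp only [hF]
      rw [abs_mul, abs_zpow, Real.mul_rpow (by positivity) hy'.le, ← Real.rpow_intCast |x|,
        ← Real.rpow_mul hx'.le, Real.rpow_sub hx', Real.rpow_one]
      field_simp
    rw [hin, ENNReal.mul_rpow_of_nonneg _ _ hp0.le,
      ENNReal.ofReal_rpow_of_nonneg (by positivity) hp0.le, ← mul_assoc,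
      ← ENNReal.ofReal_mul (by positivity), ← Real.rpow_mul hy'.le,
      Real.rpow_sub_one hy'.ne', mul_comm σ p, inv_mul_eq_div]
  rw [hKeq] at hK0 hK1
  rw [hAeq] at hA0 hA1
  rw [hKeq, hAeq, hLeq]
  exact lintegral_dilation_kernel_zpow_rpow_lt hp hδ hkm hFm hF0 hK0.ne' hK1.ne hA0.ne' hA1.ne
end

section
/- Let p > 1 and let q satisfy 1/p + 1/q = 1, let σ ∈ ℝ, let δ ∈ {−1, 1}, and let H be a nonnegative Lebesgue-measurable function on ℝ with K(σ) := ∫_{−∞}^{∞} H(t) |t|^{σ-1} dt satisfying 0 < K(σ) < ∞. For i = 1, 2 let −∞ ≤ aᵢ < bᵢ ≤ ∞ and let vᵢ : (aᵢ, bᵢ) → ℝ be differentiable with vᵢ′(s) > 0 for all s ∈ (aᵢ, bᵢ), vᵢ(s) → −∞ as s → aᵢ⁺, and vᵢ(s) → ∞ as s → bᵢ⁻. Let f, g be nonnegative measurable functions on (a₁, b₁) and (a₂, b₂) respectively, such that 0 < ∫_{a₁}^{b₁} |v₁(x)|^{p(1−δσ)−1} f(x)^p / v₁′(x)^{p−1}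 dx < ∞ and 0 < ∫_{a₂}^{b₂} |v₂(y)|^{q(1−σ)−1} g(y)^q / v₂′(y)^{q−1} dy < ∞. Then ∫_{a₂}^{b₂} ∫_{a₁}^{b₁} H(v₁(x)^δ · v₂(y)) f(x) g(y) dx dy < K(σ) · (∫_{a₁}^{b₁} |v₁(x)|^{p(1−δσ)−1} f(x)^p / v₁′(x)^{p−1} dx)^{1/p} · (∫_{a₂}^{b₂} |v₂(y)|^{q(1−σ)−1} g(y)^q / v₂′(y)^{q−1} dy)^{1/q}. -/
open MeasureTheory Set Filter

open scoped ENNReal NNReal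

/-- The Haar measure `du / |u|` of the multiplicative group `ℝˣ`, as a measure on `ℝ`. -/
noncomputable def mulHaarReal : Measure ℝ :=
  volume.withDensity fun u => ENNReal.ofReal |u|⁻¹

instance : SFinite mulHaarReal := by unfold mulHaarReal; infer_instance

lemma lintegral_mulHaarReal {φ : ℝ → ℝ≥0∞} (hφ : Measurable φ) :
    ∫⁻ u, φ u ∂mulHaarReal = ∫⁻ u, ENNReal.ofReal |u|⁻¹ * φ u := by
  rw [mulHaarReal, lintegral_withDensity_eq_lintegral_mul _ (by fun_prop) hφ]
  rfl

lemma mulHaarReal_absolutelyContinuous : mulHaarReal ≪ volume :=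
  withDensity_absolutelyContinuous _ _

lemma ae_mulHaarReal_ne_zero : ∀ᵐ u ∂mulHaarReal, u ≠ 0 :=
  mulHaarReal_absolutelyContinuous.ae_le (Measure.ae_ne volume 0)

lemma lintegral_mulHaarReal_mul_zpow {φ : ℝ → ℝ≥0∞} (hφ : Measurable φ) {t : ℝ} (ht : t ≠ 0)
    {ε : ℤ} (hε : ε = -1 ∨ ε = 1) :
    ∫⁻ u, φ (t * u ^ ε) ∂mulHaarReal = ∫⁻ u, φ u ∂mulHaarReal := by
  have hεε : ε * ε = 1 := by rcases hε with rfl | rfl <;> norm_num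
  have hε1 : |(ε : ℝ)| = 1 := by rcases hε with rfl | rfl <;> norm_num
  have hmeas : Measurable fun u : ℝ => φ (t * u ^ ε) := by fun_prop
  rw [lintegral_mulHaarReal hmeas, lintegral_mulHaarReal hφ]
  have hc : ({0}ᶜ : Set ℝ) =ᵐ[volume] univ := by simp [ae_eq_univ]
  have hinj : InjOn (fun u : ℝ => t * u ^ ε) {0}ᶜ := by
    intro x hx y hy hxy
    have h1 : x ^ ε = y ^ ε := mul_left_cancel₀ ht hxy
    have h2 := congrArg (· ^ ε) h1
    simpa [← zpow_mul, hεε] using h2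
  have himg : (fun u : ℝ => t * u ^ ε) '' {0}ᶜ = {0}ᶜ := by
    ext y
    constructor
    · rintro ⟨x, hx, rfl⟩
      exact mul_ne_zero ht (zpow_ne_zero _ hx)
    · intro hy
      refine ⟨(y / t) ^ ε, zpow_ne_zero _ (div_ne_zero hy ht), ?_⟩
      simp only [← zpow_mul, hεε, zpow_one]
      field_simp
  have key := lintegral_image_eq_lintegral_abs_deriv_mul (s := ({0}ᶜ : Set ℝ))
    (f := fun u : ℝ => t * u ^ ε) (f' := fun u => t * (ε * u ^ (ε - 1)))
    (measurableSet_singleton 0).compl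
    (fun x hx => ((hasDerivAt_zpow ε x (Or.inl hx)).const_mul t).hasDerivWithinAt) hinj
    (fun u => ENNReal.ofReal |u|⁻¹ * φ u)
  rw [himg] at key
  rw [← setLIntegral_univ, ← setLIntegral_congr hc, ← setLIntegral_univ (μ := volume) (f := fun u =>
    ENNReal.ofReal |u|⁻¹ * φ u), ← setLIntegral_congr hc, key]
  refine setLIntegral_congr_fun (measurableSet_singleton 0).compl fun u hu => ?_
  have hu : u ≠ 0 := hu
  rw [← mul_assoc, ← ENNReal.ofReal_mul (abs_nonneg _)]
  congr 2
  rw [zpow_sub_one₀ hu]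
  have h1 : |u ^ ε| ≠ 0 := abs_ne_zero.2 (zpow_ne_zero _ hu)
  have h2 : |t| ≠ 0 := abs_ne_zero.2 ht
  have h3 : |u| ≠ 0 := abs_ne_zero.2 hu
  simp only [abs_mul, hε1, abs_inv]
  field_simp

/-- Equality case of Young's inequality. -/
lemma NNReal.rpow_eq_rpow_of_young_le {p q : ℝ} (hpq : p.HolderConjugate q) {a b : ℝ≥0}
    (h : (a : ℝ) ^ p / p + (b : ℝ) ^ q / q ≤ a * b) : a ^ p = b ^ q := by
  have hle := Real.young_inequality_of_nonneg a.coe_nonneg b.coe_nonneg hpq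
  have heq : ((a : ℝ) ^ p) ^ p⁻¹ * ((b : ℝ) ^ q) ^ q⁻¹ = p⁻¹ * (a : ℝ) ^ p + q⁻¹ * (b : ℝ) ^ q := by
    rw [Real.rpow_rpow_inv a.coe_nonneg hpq.ne_zero, Real.rpow_rpow_inv b.coe_nonneg hpq.symm.ne_zero,
      le_antisymm hle h]
    ring
  have := (Real.geom_mean_eq_arith_mean_weighted_iff_of_pos Finset.univ ![p⁻¹, q⁻¹]
    ![(a : ℝ) ^ p, (b : ℝ) ^ q]
    (by simp [Fin.forall_fin_two, hpq.pos, hpq.symm.pos])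
    (by simpa [Fin.sum_univ_two] using hpq.inv_add_inv_eq_one)
    (by simp only [Fin.forall_fin_two]; simp; constructor <;> positivity)).1
    (by simpa [Fin.sum_univ_two, Fin.prod_univ_two] using heq)
  have h01 := this 0 (Finset.mem_univ _) 1 (Finset.mem_univ _)
  simp only [Matrix.cons_val_zero, Matrix.cons_val_one] at h01
  exact_mod_cast h01

/-- Equality case of Hölder's inequality for normalized functions. -/
lemma lintegral_mul_le_one_and_ae_eq {α : Type*} [MeasurableSpace α] {μ : Measure α} {p q : ℝ}
    (hpq : p.HolderConjugate q) {F G : α → ℝ≥0} (hF : Measurable F) (hG : Measurable G)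
    (hF1 : ∫⁻ u, (F u : ℝ≥0∞) ^ p ∂μ = 1) (hG1 : ∫⁻ u, (G u : ℝ≥0∞) ^ q ∂μ = 1) :
    ∫⁻ u, (F u : ℝ≥0∞) * G u ∂μ ≤ 1 ∧
      (∫⁻ u, (F u : ℝ≥0∞) * G u ∂μ = 1 → ∀ᵐ u ∂μ, F u ^ p = G u ^ q) := by
  have hsum : ∫⁻ u, ((F u : ℝ≥0∞) ^ p / ENNReal.ofReal p + (G u : ℝ≥0∞) ^ q / ENNReal.ofReal q) ∂μ
      = 1 := by
    simp only [div_eq_mul_inv]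
    rw [lintegral_add_left (by fun_prop), lintegral_mul_const _ (by fun_prop),
      lintegral_mul_const _ (by fun_prop), hF1, hG1, one_mul, one_mul, hpq.inv_add_inv_ennreal]
  have hle : ∀ u, (F u : ℝ≥0∞) * G u ≤
      (F u : ℝ≥0∞) ^ p / ENNReal.ofReal p + (G u : ℝ≥0∞) ^ q / ENNReal.ofReal q :=
    fun u => ENNReal.young_inequality _ _ hpq
  refine ⟨(lintegral_mono hle).trans_eq hsum, fun h => ?_⟩
  have hae := ae_eq_of_ae_le_of_lintegral_le (ae_of_all _ hle) (h ▸ ENNReal.one_ne_top)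
    (by fun_prop) (hsum.trans h.symm).le
  filter_upwards [hae] with u hu
  refine NNReal.rpow_eq_rpow_of_young_le hpq ?_
  have := congrArg ENNReal.toReal hu
  rw [ENNReal.toReal_mul, ENNReal.toReal_add, ENNReal.toReal_div, ENNReal.toReal_div,
    ← ENNReal.toReal_rpow, ← ENNReal.toReal_rpow, ENNReal.toReal_ofReal hpq.nonneg,
    ENNReal.toReal_ofReal hpq.symm.nonneg] at this
  · exact this.ge
  · exact (ENNReal.div_lt_top (by simp [hpq.nonneg]) (by simp [hpq.pos])).ne
  · exact (ENNReal.div_lt_top (by simp [hpq.symm.nonneg]) (by simp [hpq.symm.pos])).ne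

lemma exists_measurable_density_and_lintegral_comp {S : Set ℝ} {a b : EReal} (hab : a < b)
    (hS : S = {x : ℝ | a < (x : EReal) ∧ (x : EReal) < b}) {v v' : ℝ → ℝ}
    (hd : ∀ s ∈ S, HasDerivAt v (v' s) s) (hv' : ∀ s ∈ S, 0 < v' s)
    (ha : Tendsto v (Filter.comap (fun x : ℝ => (x : EReal)) (nhdsWithin a (Ioi a))) atBot)
    (hb : Tendsto v (Filter.comap (fun x : ℝ => (x : EReal)) (nhdsWithin b (Iio b))) atTop)
    {f : ℝ → ℝ} (hf : Measurable f) (hf0 : ∀ x ∈ S, 0 ≤ f x) :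
    MeasurableSet S ∧
      (∃ k : ℝ → ℝ, Measurable k ∧ (∀ u, 0 ≤ k u) ∧ ∀ x ∈ S, k (v x) = f x / v' x) ∧
      ∀ φ : ℝ → ℝ≥0∞, ∫⁻ x in S, ENNReal.ofReal (v' x) * φ (v x) = ∫⁻ u, φ u := by
  have hSpre : S = (fun x : ℝ => (x : EReal)) ⁻¹' Ioo a b := hS
  have hord : S.OrdConnected := by
    rw [hSpre]
    exact ordConnected_Ioo.preimage_mono fun _ _ h => EReal.coe_le_coe h
  have hopen : IsOpen S := by
    rw [hSpre]
    exact isOpen_Ioo.preimage continuous_coe_real_ereal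
  have hcont : ContinuousOn v S := fun s hs => (hd s hs).continuousAt.continuousWithinAt
  have hmono : StrictMonoOn v S := by
    refine strictMonoOn_of_deriv_pos hord.convex hcont fun s hs => ?_
    rw [(hd s (interior_subset hs)).deriv]
    exact hv' s (interior_subset hs)
  have hA : NeBot (comap (fun x : ℝ => (x : EReal)) (nhdsWithin a (Ioi a))) := by
    refine comap_neBot fun t ht => ?_
    obtain ⟨c, hc, hct⟩ := (mem_nhdsGT_iff_exists_Ioo_subset' hab).1 ht
    obtain ⟨x, hx1, hx2⟩ := EReal.lt_iff_exists_real_btwn.1 hc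
    exact ⟨x, hct ⟨hx1, hx2⟩⟩
  have hB : NeBot (comap (fun x : ℝ => (x : EReal)) (nhdsWithin b (Iio b))) := by
    refine comap_neBot fun t ht => ?_
    obtain ⟨c, hc, hct⟩ := (mem_nhdsLT_iff_exists_Ioo_subset' hab).1 ht
    obtain ⟨x, hx1, hx2⟩ := EReal.lt_iff_exists_real_btwn.1 hc
    exact ⟨x, hct ⟨hx1, hx2⟩⟩
  have himg : v '' S = univ := by
    refine univ_subset_iff.1 (hord.isPreconnected.intermediate_value_Iii ?_ ?_ hcont ha hb)
    · rw [le_principal_iff, hSpre]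
      exact preimage_mem_comap (Ioo_mem_nhdsGT hab)
    · rw [le_principal_iff, hSpre]
      exact preimage_mem_comap (Ioo_mem_nhdsLT hab)
  refine ⟨hopen.measurableSet, ?_, fun φ => ?_⟩
  · have hex : ∀ u, ∃ x ∈ S, v x = u := fun u => by
      have : u ∈ v '' S := himg ▸ mem_univ u
      exact this
    choose w hwS hwv using hex
    have hw : Measurable w := Monotone.measurable fun u₁ u₂ hu => by
      rwa [← hmono.le_iff_le (hwS _) (hwS _), hwv, hwv]
    refine ⟨fun u => f (w u) / deriv v (w u),
      (hf.comp hw).div ((measurable_deriv v).comp hw), fun u => ?_, fun x hx => ?_⟩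
    · simp only [(hd _ (hwS u)).deriv]
      exact div_nonneg (hf0 _ (hwS u)) (hv' _ (hwS u)).le
    · have hwx : w (v x) = x := hmono.injOn (hwS _) hx (hwv _)
      simp only [hwx, (hd x hx).deriv]
  · rw [← setLIntegral_univ φ, ← himg, lintegral_image_eq_lintegral_abs_deriv_mul
      hopen.measurableSet (fun s hs => (hd s hs).hasDerivWithinAt) hmono.injOn]
    refine setLIntegral_congr_fun hopen.measurableSet fun s hs => ?_
    simp only [abs_of_pos (hv' s hs)]

lemma lintegral_lintegral_mulHaarReal_lt_of_normalized {p q : ℝ} (hpq : p.HolderConjugate q) {δ : ℤ}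
    (hδ : δ = -1 ∨ δ = 1) {h : ℝ → ℝ≥0∞} (hh : Measurable h)
    (h0 : ∫⁻ t, h t ∂mulHaarReal ≠ 0) (h1 : ∫⁻ t, h t ∂mulHaarReal ≠ ∞)
    {F G : ℝ → ℝ≥0} (hF : Measurable F) (hG : Measurable G)
    (hF1 : ∫⁻ u, (F u : ℝ≥0∞) ^ p ∂mulHaarReal = 1)
    (hG1 : ∫⁻ u, (G u : ℝ≥0∞) ^ q ∂mulHaarReal = 1) :
    ∫⁻ w, ∫⁻ u, h (u ^ δ * w) * F u * G w ∂mulHaarReal ∂mulHaarReal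
      < ∫⁻ t, h t ∂mulHaarReal := by
  have hδ' : -δ = -1 ∨ -δ = 1 := by rcases hδ with rfl | rfl <;> simp
  set J : ℝ → ℝ≥0∞ := fun t => ∫⁻ u, (F u : ℝ≥0∞) * G (t * u ^ (-δ)) ∂mulHaarReal with hJ
  have hJmeas : Measurable J := by
    refine Measurable.lintegral_prod_right' (f := fun z : ℝ × ℝ =>
      (F z.2 : ℝ≥0∞) * G (z.1 * z.2 ^ (-δ))) (by fun_prop)
  have hI : ∫⁻ w, ∫⁻ u, h (u ^ δ * w) * F u * G w ∂mulHaarReal ∂mulHaarReal =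
      ∫⁻ t, h t * J t ∂mulHaarReal := by
    rw [lintegral_lintegral_swap (by unfold Function.uncurry; fun_prop)]
    have hstep : ∀ᵐ u ∂mulHaarReal, ∫⁻ w, h (u ^ δ * w) * F u * G w ∂mulHaarReal =
        ∫⁻ t, h t * F u * G (t * u ^ (-δ)) ∂mulHaarReal := by
      filter_upwards [ae_mulHaarReal_ne_zero] with u hu
      have := lintegral_mulHaarReal_mul_zpow (φ := fun t => h t * F u * G (t * u ^ (-δ)))
        (by fun_prop) (zpow_ne_zero δ hu) (ε := 1) (Or.inr rfl)
      rw [← this]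
      refine lintegral_congr fun w => ?_
      have hw : u ^ δ * w * u ^ (-δ) = w := by
        rw [zpow_neg, mul_right_comm, mul_inv_cancel₀ (zpow_ne_zero δ hu), one_mul]
      rw [zpow_one, hw]
    rw [lintegral_congr_ae hstep, lintegral_lintegral_swap (by unfold Function.uncurry; fun_prop)]
    refine lintegral_congr fun t => ?_
    simp only [mul_assoc]
    rw [lintegral_const_mul _ (by fun_prop)]
  have hGt : ∀ t ≠ 0, ∫⁻ u, (G (t * u ^ (-δ)) : ℝ≥0∞) ^ q ∂mulHaarReal = 1 := fun t ht =>
    (lintegral_mulHaarReal_mul_zpow (φ := fun t => (G t : ℝ≥0∞) ^ q) (by fun_prop) ht hδ').trans hG1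
  have hHolder := fun t ht => lintegral_mul_le_one_and_ae_eq (μ := mulHaarReal) hpq hF
    (G := fun u => G (t * u ^ (-δ))) (by fun_prop) hF1 (hGt t ht)
  have hle : ∀ᵐ t ∂mulHaarReal, h t * J t ≤ h t := by
    filter_upwards [ae_mulHaarReal_ne_zero] with t ht
    exact mul_le_of_le_one_right' (hHolder t ht).1
  rw [hI]
  by_contra hlt
  rw [not_lt] at hlt
  have hIfin : ∫⁻ t, h t * J t ∂mulHaarReal ≠ ∞ :=
    ((lintegral_mono_ae hle).trans_lt h1.lt_top).ne
  have hae := ae_eq_of_ae_le_of_lintegral_le hle hIfin hh.aemeasurable hlt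
  have hfreq : ∃ᵐ t ∂mulHaarReal, h t ≠ 0 := by
    intro hn
    refine h0 ((lintegral_eq_zero_iff hh).2 ?_)
    filter_upwards [hn] with t ht using not_not.1 ht
  have hgood : ∃ᵐ t ∂mulHaarReal, t ≠ 0 ∧ ∀ᵐ u ∂mulHaarReal, F u ^ p = G (t * u ^ (-δ)) ^ q := by
    refine (hfreq.and_eventually (hae.and ((ae_lt_top hh h1).and ae_mulHaarReal_ne_zero))).mono ?_
    rintro t ⟨ht, hteq, htfin, ht0⟩
    refine ⟨ht0, (hHolder t ht0).2 ?_⟩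
    have hteq' : h t * J t = h t * 1 := by rw [mul_one]; exact hteq
    exact (ENNReal.mul_right_inj ht htfin.ne).1 hteq'
  obtain ⟨s, hs0, hs⟩ := hgood.exists
  have hne : ∀ᵐ t ∂mulHaarReal, |t| ≠ |s| := by
    refine mulHaarReal_absolutelyContinuous.ae_le ?_
    filter_upwards [Measure.ae_ne volume s, Measure.ae_ne volume (-s)] with t h1 h2 h3
    rcases abs_eq_abs.1 h3 with h | h
    exacts [h1 h, h2 h]
  obtain ⟨r, ⟨hr0, hr⟩, hrs⟩ := (hgood.and_eventually hne).exists
  have main : ∀ x y : ℝ, x ≠ 0 → y ≠ 0 → |x| < |y| →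
      (∀ᵐ u ∂mulHaarReal, F u ^ p = G (x * u ^ (-δ)) ^ q) →
      (∀ᵐ u ∂mulHaarReal, F u ^ p = G (y * u ^ (-δ)) ^ q) → False := by
    intro x y hx0 hy0 hxy hx hy
    set ψ : ℝ → ℝ≥0∞ := fun u => ENNReal.ofReal (1 + |u|)⁻¹ with hψ
    have hψle : ∀ u, ψ u ≤ 1 := fun u => by
      rw [hψ, ENNReal.ofReal_le_one]
      exact inv_le_one_of_one_le₀ (by linarith [abs_nonneg u])
    have hinv : ∀ t ≠ 0, ∫⁻ u, (G (t * u ^ (-δ)) : ℝ≥0∞) ^ q * ψ (t * u ^ (-δ)) ∂mulHaarReal =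
        ∫⁻ u, (G u : ℝ≥0∞) ^ q * ψ u ∂mulHaarReal := fun t ht =>
      lintegral_mulHaarReal_mul_zpow (φ := fun t => (G t : ℝ≥0∞) ^ q * ψ t) (by fun_prop) ht hδ'
    have hψlt : ∀ u, u ≠ 0 → ψ (y * u ^ (-δ)) < ψ (x * u ^ (-δ)) := by
      intro u hu
      have hu' : 0 < |u ^ (-δ)| := abs_pos.2 (zpow_ne_zero _ hu)
      rw [hψ, ENNReal.ofReal_lt_ofReal_iff (by positivity), abs_mul, abs_mul]
      gcongr
    have hFx : ∀ t, (∀ᵐ u ∂mulHaarReal, F u ^ p = G (t * u ^ (-δ)) ^ q) →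
        ∀ᵐ u ∂mulHaarReal, (G (t * u ^ (-δ)) : ℝ≥0∞) ^ q = (F u : ℝ≥0∞) ^ p := by
      intro t ht
      filter_upwards [ht] with u hu
      rw [← ENNReal.coe_rpow_of_nonneg _ hpq.nonneg, ← ENNReal.coe_rpow_of_nonneg _ hpq.symm.nonneg,
        hu]
    have hint : ∀ t ≠ 0, (∀ᵐ u ∂mulHaarReal, F u ^ p = G (t * u ^ (-δ)) ^ q) →
        ∫⁻ u, (F u : ℝ≥0∞) ^ p * ψ (t * u ^ (-δ)) ∂mulHaarReal =
          ∫⁻ u, (G u : ℝ≥0∞) ^ q * ψ u ∂mulHaarReal := by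
      intro t ht0 ht
      rw [← hinv t ht0]
      refine lintegral_congr_ae ?_
      filter_upwards [hFx t ht] with u hu
      rw [hu]
    have hzero : ∀ᵐ u ∂mulHaarReal, (F u : ℝ≥0∞) ^ p = 0 := by
      have hle' : ∀ᵐ u ∂mulHaarReal,
          (F u : ℝ≥0∞) ^ p * ψ (y * u ^ (-δ)) ≤ (F u : ℝ≥0∞) ^ p * ψ (x * u ^ (-δ)) := by
        filter_upwards [ae_mulHaarReal_ne_zero] with u hu
        exact mul_le_mul_right (hψlt u hu).le _
      have hfin : ∫⁻ u, (F u : ℝ≥0∞) ^ p * ψ (y * u ^ (-δ)) ∂mulHaarReal ≠ ∞ := by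
        refine ((lintegral_mono fun u => ?_).trans_lt (hF1.trans_lt ENNReal.one_lt_top)).ne
        exact mul_le_of_le_one_right' (hψle _)
      have := ae_eq_of_ae_le_of_lintegral_le hle' hfin (by fun_prop)
        ((hint x hx0 hx).trans (hint y hy0 hy).symm).le
      filter_upwards [this, ae_mulHaarReal_ne_zero] with u hu hu0
      by_contra hne0
      exact (hψlt u hu0).ne ((ENNReal.mul_right_inj hne0
        (ENNReal.rpow_ne_top_of_nonneg hpq.nonneg ENNReal.coe_ne_top)).1 hu)
    rw [lintegral_congr_ae hzero, lintegral_zero] at hF1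
    exact zero_ne_one hF1
  rcases hrs.lt_or_gt with hlt' | hlt'
  exacts [main r s hr0 hs0 hlt' hr hs, main s r hs0 hr0 hlt' hs hr]

lemma lintegral_lintegral_mulHaarReal_lt {p q : ℝ} (hpq : p.HolderConjugate q) {δ : ℤ}
    (hδ : δ = -1 ∨ δ = 1) {h : ℝ → ℝ≥0∞} (hh : Measurable h)
    (h0 : ∫⁻ t, h t ∂mulHaarReal ≠ 0) (h1 : ∫⁻ t, h t ∂mulHaarReal ≠ ∞)
    {F G : ℝ → ℝ≥0} (hF : Measurable F) (hG : Measurable G)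
    (hF0 : ∫⁻ u, (F u : ℝ≥0∞) ^ p ∂mulHaarReal ≠ 0)
    (hF1 : ∫⁻ u, (F u : ℝ≥0∞) ^ p ∂mulHaarReal ≠ ∞)
    (hG0 : ∫⁻ u, (G u : ℝ≥0∞) ^ q ∂mulHaarReal ≠ 0)
    (hG1 : ∫⁻ u, (G u : ℝ≥0∞) ^ q ∂mulHaarReal ≠ ∞) :
    ∫⁻ w, ∫⁻ u, h (u ^ δ * w) * F u * G w ∂mulHaarReal ∂mulHaarReal
      < (∫⁻ t, h t ∂mulHaarReal) * (∫⁻ u, (F u : ℝ≥0∞) ^ p ∂mulHaarReal) ^ (1 / p) *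
        (∫⁻ u, (G u : ℝ≥0∞) ^ q ∂mulHaarReal) ^ (1 / q) := by
  have hnorm : ∀ {r : ℝ} {f : ℝ → ℝ≥0}, 0 < r → Measurable f →
      ∫⁻ u, (f u : ℝ≥0∞) ^ r ∂mulHaarReal ≠ 0 → ∫⁻ u, (f u : ℝ≥0∞) ^ r ∂mulHaarReal ≠ ∞ →
      ∃ a : ℝ≥0, a ≠ 0 ∧ (∫⁻ u, (f u : ℝ≥0∞) ^ r ∂mulHaarReal) ^ (1 / r) = a ∧
        ∫⁻ u, ((f u * a⁻¹ : ℝ≥0) : ℝ≥0∞) ^ r ∂mulHaarReal = 1 := by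
    intro r f hr hf hf0 hf1
    set A := ∫⁻ u, (f u : ℝ≥0∞) ^ r ∂mulHaarReal with hA
    have hAtop : A ^ (1 / r) ≠ ∞ := ENNReal.rpow_ne_top_of_nonneg (by positivity) hf1
    lift A ^ (1 / r) to ℝ≥0 using hAtop with a ha
    have ha0 : a ≠ 0 := by
      rintro rfl
      rw [ENNReal.coe_zero, eq_comm, ENNReal.rpow_eq_zero_iff] at ha
      rcases ha with ha | ha
      exacts [hf0 ha.1, hf1 ha.1]
    refine ⟨a, ha0, rfl, ?_⟩
    simp only [ENNReal.coe_mul, ENNReal.coe_inv ha0, ENNReal.mul_rpow_of_nonneg _ _ hr.le]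
    rw [lintegral_mul_const _ (by fun_prop), ← hA, ha, ENNReal.inv_rpow, ← ENNReal.rpow_mul,
      one_div_mul_cancel hr.ne', ENNReal.rpow_one, ENNReal.mul_inv_cancel hf0 hf1]
  obtain ⟨a, ha0, ha, hFa⟩ := hnorm hpq.pos hF hF0 hF1
  obtain ⟨b, hb0, hb, hGb⟩ := hnorm hpq.symm.pos hG hG0 hG1
  have key := lintegral_lintegral_mulHaarReal_lt_of_normalized hpq hδ hh h0 h1
    (hF.mul_const a⁻¹) (hG.mul_const b⁻¹) hFa hGb
  have hscale : ∫⁻ w, ∫⁻ u, h (u ^ δ * w) * F u * G w ∂mulHaarReal ∂mulHaarReal =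
      (∫⁻ w, ∫⁻ u, h (u ^ δ * w) * (F u * a⁻¹ : ℝ≥0) * (G w * b⁻¹ : ℝ≥0)
        ∂mulHaarReal ∂mulHaarReal) * (a * b) := by
    rw [← lintegral_mul_const' _ _ (by finiteness)]
    refine lintegral_congr fun w => ?_
    rw [← lintegral_mul_const' _ _ (by finiteness)]
    refine lintegral_congr fun u => ?_
    have hFu : (F u : ℝ≥0∞) = (F u * a⁻¹ : ℝ≥0) * a := by
      rw [← ENNReal.coe_mul, inv_mul_cancel_right₀ ha0]
    have hGw : (G w : ℝ≥0∞) = (G w * b⁻¹ : ℝ≥0) * b := by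
      rw [← ENNReal.coe_mul, inv_mul_cancel_right₀ hb0]
    rw [hFu, hGw]
    ring
  rw [ha, hb, hscale, mul_assoc]
  exact ENNReal.mul_lt_mul_left (mul_ne_zero (by simpa) (by simpa)) (by finiteness) key

lemma setLIntegral_rpow_eq_lintegral_mulHaarReal {S : Set ℝ} (hS : MeasurableSet S)
    {v v' f k : ℝ → ℝ} (hv' : ∀ s ∈ S, 0 < v' s) (hf0 : ∀ s ∈ S, 0 ≤ f s)
    (hk : Measurable k) (hk0 : ∀ u, 0 ≤ k u) (hkv : ∀ s ∈ S, k (v s) = f s / v' s)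
    (hcov : ∀ φ : ℝ → ℝ≥0∞, ∫⁻ x in S, ENNReal.ofReal (v' x) * φ (v x) = ∫⁻ u, φ u)
    {r : ℝ} (hr : 0 < r) (β : ℝ) :
    ∫⁻ x in S, ENNReal.ofReal (|v x| ^ (r * (1 - β) - 1) * f x ^ r / v' x ^ (r - 1)) =
      ∫⁻ u, ((k u * |u| ^ (1 - β)).toNNReal : ℝ≥0∞) ^ r ∂mulHaarReal := by
  rw [lintegral_mulHaarReal (by fun_prop)]
  calc _ = ∫⁻ x in S, ENNReal.ofReal (v' x) *
        ENNReal.ofReal (|v x| ^ (r * (1 - β) - 1) * k (v x) ^ r) := by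
        refine setLIntegral_congr_fun hS fun s hs => ?_
        have h' := hv' s hs
        simp only [hkv s hs]
        rw [← ENNReal.ofReal_mul h'.le, Real.div_rpow (hf0 s hs) h'.le, Real.rpow_sub_one h'.ne']
        congr 1
        field_simp
    _ = ∫⁻ u, ENNReal.ofReal (|u| ^ (r * (1 - β) - 1) * k u ^ r) :=
        hcov fun u => ENNReal.ofReal (|u| ^ (r * (1 - β) - 1) * k u ^ r)
    _ = _ := by
        refine lintegral_congr_ae ?_
        filter_upwards [Measure.ae_ne volume 0] with u hu
        have hu' : 0 < |u| := abs_pos.2 hu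
        change _ = _ * ENNReal.ofReal _ ^ r
        rw [ENNReal.ofReal_rpow_of_nonneg (mul_nonneg (hk0 u) (by positivity)) hr.le,
          ← ENNReal.ofReal_mul (by positivity), Real.mul_rpow (hk0 u) (by positivity),
          ← Real.rpow_mul hu'.le, Real.rpow_sub_one hu'.ne', mul_comm r]
        congr 1
        field_simp

/-- Whole-plane Yang–Hilbert-type inequality with multi-variables: for strictly increasing
differentiable substitutions `vᵢ : (aᵢ,bᵢ) → ℝ` with `vᵢ(aᵢ⁺) = -∞`, `vᵢ(bᵢ⁻) = ∞`, and
`δ ∈ {-1,1}`,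
`∫∫ H(v₁(x)^δ v₂(y)) f(x) g(y) dx dy
  < K(σ) (∫ |v₁|^{p(1-δσ)-1} f^p / v₁'^{p-1})^{1/p} (∫ |v₂|^{q(1-σ)-1} g^q / v₂'^{q-1})^{1/q}`. -/
theorem stmt19 (p q σ : ℝ) (hp : 1 < p) (hpq : 1 / p + 1 / q = 1)
    (δ : ℤ) (hδ : δ = -1 ∨ δ = 1)
    (H : ℝ → ℝ) (hH : Measurable H) (hH0 : ∀ t : ℝ, 0 ≤ H t)
    (hK0 : 0 < ∫⁻ t : ℝ, ENNReal.ofReal (H t * |t| ^ (σ - 1)))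
    (hK1 : (∫⁻ t : ℝ, ENNReal.ofReal (H t * |t| ^ (σ - 1))) < ⊤)
    (a₁ b₁ a₂ b₂ : EReal) (hab₁ : a₁ < b₁) (hab₂ : a₂ < b₂)
    (S₁ S₂ : Set ℝ)
    (hS₁ : S₁ = {x : ℝ | a₁ < (x : EReal) ∧ (x : EReal) < b₁})
    (hS₂ : S₂ = {y : ℝ | a₂ < (y : EReal) ∧ (y : EReal) < b₂})
    (v₁ v₂ v₁' v₂' : ℝ → ℝ)
    (hv₁d : ∀ s ∈ S₁, HasDerivAt v₁ (v₁' s) s) (hv₁' : ∀ s ∈ S₁, 0 < v₁' s)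
    (hv₂d : ∀ s ∈ S₂, HasDerivAt v₂ (v₂' s) s) (hv₂' : ∀ s ∈ S₂, 0 < v₂' s)
    (hv₁a : Tendsto v₁ (Filter.comap (fun x : ℝ => (x : EReal)) (nhdsWithin a₁ (Ioi a₁)))
      atBot)
    (hv₁b : Tendsto v₁ (Filter.comap (fun x : ℝ => (x : EReal)) (nhdsWithin b₁ (Iio b₁)))
      atTop)
    (hv₂a : Tendsto v₂ (Filter.comap (fun y : ℝ => (y : EReal)) (nhdsWithin a₂ (Ioi a₂)))
      atBot)
    (hv₂b : Tendsto v₂ (Filter.comap (fun y : ℝ => (y : EReal)) (nhdsWithin b₂ (Iio b₂)))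
      atTop)
    (f g : ℝ → ℝ) (hf : Measurable f) (hg : Measurable g)
    (hf0 : ∀ x ∈ S₁, 0 ≤ f x) (hg0 : ∀ y ∈ S₂, 0 ≤ g y)
    (hA0 : 0 < ∫⁻ x in S₁,
      ENNReal.ofReal (|v₁ x| ^ (p * (1 - (δ : ℝ) * σ) - 1) * f x ^ p / v₁' x ^ (p - 1)))
    (hA1 : (∫⁻ x in S₁,
      ENNReal.ofReal (|v₁ x| ^ (p * (1 - (δ : ℝ) * σ) - 1) * f x ^ p / v₁' x ^ (p - 1))) < ⊤)
    (hB0 : 0 < ∫⁻ y in S₂,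
      ENNReal.ofReal (|v₂ y| ^ (q * (1 - σ) - 1) * g y ^ q / v₂' y ^ (q - 1)))
    (hB1 : (∫⁻ y in S₂,
      ENNReal.ofReal (|v₂ y| ^ (q * (1 - σ) - 1) * g y ^ q / v₂' y ^ (q - 1))) < ⊤) :
    (∫⁻ y in S₂, ∫⁻ x in S₁, ENNReal.ofReal (H (v₁ x ^ δ * v₂ y) * f x * g y))
      < (∫⁻ t : ℝ, ENNReal.ofReal (H t * |t| ^ (σ - 1))) *
          (∫⁻ x in S₁,
            ENNReal.ofReal (|v₁ x| ^ (p * (1 - (δ : ℝ) * σ) - 1) * f x ^ p /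
              v₁' x ^ (p - 1))) ^ (1 / p) *
          (∫⁻ y in S₂,
            ENNReal.ofReal (|v₂ y| ^ (q * (1 - σ) - 1) * g y ^ q /
              v₂' y ^ (q - 1))) ^ (1 / q) := by
  have hp0 : 0 < p := one_pos.trans hp
  have hpq' : p.HolderConjugate q := by
    refine Real.holderConjugate_iff.2 ⟨hp, ?_⟩
    simpa only [one_div] using hpq
  obtain ⟨hS₁m, ⟨k₁, hk₁, hk₁0, hk₁v⟩, hcov₁⟩ :=
    exists_measurable_density_and_lintegral_comp hab₁ hS₁ hv₁d hv₁' hv₁a hv₁b hf hf0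
  obtain ⟨hS₂m, ⟨k₂, hk₂, hk₂0, hk₂v⟩, hcov₂⟩ :=
    exists_measurable_density_and_lintegral_comp hab₂ hS₂ hv₂d hv₂' hv₂a hv₂b hg hg0
  rw [setLIntegral_rpow_eq_lintegral_mulHaarReal hS₁m hv₁' hf0 hk₁ hk₁0 hk₁v hcov₁ hp0]
    at hA0 hA1 ⊢
  rw [setLIntegral_rpow_eq_lintegral_mulHaarReal hS₂m hv₂' hg0 hk₂ hk₂0 hk₂v hcov₂
    hpq'.symm.pos] at hB0 hB1 ⊢
  have hK : ∫⁻ t : ℝ, ENNReal.ofReal (H t * |t| ^ (σ - 1)) =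
      ∫⁻ t, ENNReal.ofReal (H t * |t| ^ σ) ∂mulHaarReal := by
    rw [lintegral_mulHaarReal (by fun_prop)]
    refine lintegral_congr_ae ?_
    filter_upwards [Measure.ae_ne volume 0] with t ht
    rw [← ENNReal.ofReal_mul (by positivity), Real.rpow_sub_one (abs_ne_zero.2 ht)]
    congr 1
    ring
  rw [hK] at hK0 hK1 ⊢
  refine lt_of_eq_of_lt ?_ (lintegral_lintegral_mulHaarReal_lt hpq' hδ (by fun_prop)
    hK0.ne' hK1.ne (by fun_prop) (by fun_prop) hA0.ne' hA1.ne hB0.ne' hB1.ne)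
  calc ∫⁻ y in S₂, ∫⁻ x in S₁, ENNReal.ofReal (H (v₁ x ^ δ * v₂ y) * f x * g y)
      = ∫⁻ y in S₂, ENNReal.ofReal (v₂' y) *
          ∫⁻ u, ENNReal.ofReal (H (u ^ δ * v₂ y) * k₁ u * k₂ (v₂ y)) := by
        refine setLIntegral_congr_fun hS₂m fun y hy => ?_
        have hy' := hv₂' y hy
        rw [← hcov₁, ← lintegral_const_mul' _ _ ENNReal.ofReal_ne_top]
        refine setLIntegral_congr_fun hS₁m fun x hx => ?_
        have hx' := hv₁' x hx
        simp only [hk₁v x hx, hk₂v y hy]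
        rw [← ENNReal.ofReal_mul hx'.le, ← ENNReal.ofReal_mul hy'.le]
        congr 1
        field_simp
    _ = ∫⁻ z, ∫⁻ u, ENNReal.ofReal (H (u ^ δ * z) * k₁ u * k₂ z) :=
        hcov₂ fun z => ∫⁻ u, ENNReal.ofReal (H (u ^ δ * z) * k₁ u * k₂ z)
    _ = _ := by
        rw [lintegral_mulHaarReal (by
          refine Measurable.lintegral_prod_right' (f := fun z : ℝ × ℝ =>
            ENNReal.ofReal (H (z.2 ^ δ * z.1) * |z.2 ^ δ * z.1| ^ σ) *
              ((k₁ z.2 * |z.2| ^ (1 - (δ : ℝ) * σ)).toNNReal : ENNReal) *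
              ((k₂ z.1 * |z.1| ^ (1 - σ)).toNNReal : ENNReal)) (by fun_prop))]
        refine lintegral_congr_ae ?_
        filter_upwards [Measure.ae_ne volume 0] with z hz
        rw [lintegral_mulHaarReal (by fun_prop),
          ← lintegral_const_mul' _ _ ENNReal.ofReal_ne_top]
        refine lintegral_congr_ae ?_
        filter_upwards [Measure.ae_ne volume 0] with u hu
        have hz' : 0 < |z| := abs_pos.2 hz
        have hu' : 0 < |u| := abs_pos.2 hu
        have hH' := hH0 (u ^ δ * z)
        have h₁ := hk₁0 u
        have h₂ := hk₂0 z
        change _ = _ * (_ * (_ * ENNReal.ofReal _ * ENNReal.ofReal _))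
        rw [← ENNReal.ofReal_mul (by positivity), ← ENNReal.ofReal_mul (by positivity),
          ← ENNReal.ofReal_mul (by positivity), ← ENNReal.ofReal_mul (by positivity),
          abs_mul, abs_zpow, ← Real.rpow_intCast |u|, Real.mul_rpow (by positivity) hz'.le,
          ← Real.rpow_mul hu'.le, Real.rpow_sub hu', Real.rpow_sub hz', Real.rpow_one,
          Real.rpow_one]
        congr 1
        field_simp
end
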